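/- arXiv:2309.08509 — 6 statements merged into one kernel-verified Lean document; each statement's English description precedes it below -/
import Mathlib

section
/- Let Γ be a finite connected multigraph and fix, for every spanning tree T of Γ, a multidegree 𝐝_T ∈ S^d_Γ(T). Then there exists at most one degree-d stability assignment σ for Γ such that σ(T) = {𝐝_T} for all spanning trees T of Γ. -/
open Finset

variable {V E : Type} [Fintype V] [Fintype E] [DecidableEq V] [DecidableEq E]

/-- The unordered pair of endpoints of an edge. -/
def eSym (ends : E → V × V) (e : E) : Sym2 V := s((ends e).1, (ends e).2)

/-- Reachability in the spanning subgraph with edge set `A`. -/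
def Linked (ends : E → V × V) (A : Finset E) : V → V → Prop :=
  Relation.ReflTransGen (fun v w => ∃ e ∈ A, eSym ends e = s(v, w))

/-- The spanning subgraph with edge set `A` is connected. -/
def Conn (ends : E → V × V) (A : Finset E) : Prop :=
  Nonempty V ∧ ∀ v w : V, Linked ends A v w

/-- The induced subgraph on the vertex set `W` is connected. -/
def ConnOn (ends : E → V × V) (W : Finset V) : Prop :=
  W.Nonempty ∧ ∀ v ∈ W, ∀ w ∈ W,
    Relation.ReflTransGen (fun a b => a ∈ W ∧ b ∈ W ∧ ∃ e : E, eSym ends e = s(a, b)) v w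

/-- A spanning tree: a connected spanning subgraph with `|V| - 1` edges. -/
def IsSpanningTree (ends : E → V × V) (A : Finset E) : Prop :=
  Conn ends A ∧ A.card + 1 = Fintype.card V

/-- The complexity of the spanning subgraph `A`: the number of its spanning trees. -/
noncomputable def complexity (ends : E → V × V) (A : Finset E) : ℕ :=
  Nat.card {T : Finset E // T ⊆ A ∧ IsSpanningTree ends T}

/-- `n(G)`: the number of edges of `Γ` missing from the spanning subgraph `G`. -/
def nG (A : Finset E) : ℕ := (Finset.univ \ A).card

/-- The space of multidegrees of total degree `d` at `A`. -/
def Sdeg (d : ℤ) (A : Finset E) : Set (V → ℤ) :=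
  {x | ∑ v, x v = d - (nG A : ℤ)}

/-- The twister at vertex `v` of the spanning subgraph with edge set `A`. -/
def twVec (ends : E → V × V) (A : Finset E) (v : V) : V → ℤ := fun w =>
  if w = v then
    -((A.filter (fun e => v ∈ eSym ends e ∧ ¬(eSym ends e).IsDiag)).card : ℤ)
  else ((A.filter (fun e => eSym ends e = s(v, w))).card : ℤ)

/-- The twister (chip-firing) group of the spanning subgraph with edge set `A`. -/
def twGroup (ends : E → V × V) (A : Finset E) : AddSubgroup (V → ℤ) :=
  AddSubgroup.closure (Set.range (twVec ends A))

/-- The standard basis vector at `v`. -/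
def stdVec (v : V) : V → ℤ := fun w => if w = v then 1 else 0

/-- A degree-`d` assignment: supported on connected spanning subgraphs, with the
prescribed total degree. -/
def IsAssignment (ends : E → V × V) (d : ℤ) (σ : Finset E → Set (V → ℤ)) : Prop :=
  ∀ A : Finset E, ∀ x ∈ σ A, Conn ends A ∧ x ∈ Sdeg d A

/-- Condition (1), chip-adding. -/
def ChipAdding (ends : E → V × V) (σ : Finset E → Set (V → ℤ)) : Prop :=
  ∀ A : Finset E, ∀ x ∈ σ A, ∀ e ∉ A, ∀ v ∈ eSym ends e, x + stdVec v ∈ σ (insert e A)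

/-- `S` is a minimal complete set of representatives for the action of the twister group
of `A` on the multidegree space `S^d(A)`. -/
def IsRepSet (ends : E → V × V) (d : ℤ) (A : Finset E) (S : Set (V → ℤ)) : Prop :=
  S ⊆ Sdeg d A ∧ ∀ x ∈ Sdeg (E := E) d A, ∃! y, y ∈ S ∧ x - y ∈ twGroup ends A

/-- A degree-`d` stability assignment. -/
def IsStabilityAssignment (ends : E → V × V) (d : ℤ) (σ : Finset E → Set (V → ℤ)) : Prop :=
  IsAssignment ends d σ ∧ ChipAdding ends σ ∧
    ∀ A : Finset E, Conn ends A → IsRepSet ends d A (σ A)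

/-- Vertices of the subdivision `Γ̃_m`: original vertices plus, for each edge `e`,
`m e` exceptional vertices. -/
abbrev SubV (V E : Type) (m : E → ℕ) : Type := V ⊕ (Σ e : E, Fin (m e))

/-- Edges of the subdivision `Γ̃_m`: each edge `e` is replaced by a chain of `m e + 1` edges. -/
abbrev SubE (E : Type) (m : E → ℕ) : Type := Σ e : E, Fin (m e + 1)

/-- The `i`-th vertex along the chain replacing the edge `e` in the subdivision. -/
def subNode (ends : E → V × V) (m : E → ℕ) (e : E) (i : ℕ) : SubV V E m :=
  if h0 : i = 0 then Sum.inl (ends e).1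
  else if h : i ≤ m e then Sum.inr ⟨e, ⟨i - 1, by omega⟩⟩
  else Sum.inl (ends e).2

/-- The endpoints of the edges of the subdivision `Γ̃_m`. -/
def subEnds (ends : E → V × V) (m : E → ℕ) : SubE E m → SubV V E m × SubV V E m :=
  fun p => (subNode ends m p.1 p.2.val, subNode ends m p.1 (p.2.val + 1))

/-- The lift of the multidegree `x` on `(A, Γ)`: extend by zero and add one chip on
the exceptional vertex `t e` of every removed edge `e ∉ A`. -/
def liftOf (m : E → ℕ) (A : Finset E) (x : V → ℤ) (t : E → ℕ) : SubV V E m → ℤ :=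
  Sum.elim x fun p => if p.1 ∉ A ∧ (p.2 : ℕ) = t p.1 then 1 else 0

/-- The lift `σ̃_m` of an assignment `σ`: all lifts of all elements of `σ`. -/
def liftSet (m : E → ℕ) (σ : Finset E → Set (V → ℤ)) : Set (SubV V E m → ℤ) :=
  {y | ∃ (A : Finset E) (x : V → ℤ) (t : E → ℕ),
    x ∈ σ A ∧ (∀ e ∉ A, t e < m e) ∧ y = liftOf m A x t}

/-- Edges with both endpoints in `W` (the edges of the induced subgraph `Γ(W)`). -/
def inE (ends : E → V × V) (W : Finset V) : Finset E :=
  Finset.univ.filter fun e => (ends e).1 ∈ W ∧ (ends e).2 ∈ W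

/-- Edges with one endpoint in `W` and the other in `Wᶜ`. -/
def cutE (ends : E → V × V) (W : Finset V) : Finset E :=
  Finset.univ.filter fun e =>
    ((ends e).1 ∈ W ∧ (ends e).2 ∉ W) ∨ ((ends e).1 ∉ W ∧ (ends e).2 ∈ W)

/-- `φ`-semistability of the multidegree `x` on the spanning subgraph `A`. -/
def PhiSemistable (ends : E → V × V) (φ : V → ℝ) (A : Finset E) (x : V → ℤ) : Prop :=
  ∀ W : Finset V, W.Nonempty → W ≠ Finset.univ →
    |(∑ v ∈ W, ((x v : ℝ) - φ v)) + (((Finset.univ \ A) ∩ inE ends W).card : ℝ) +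
        (((Finset.univ \ A) ∩ cutE ends W).card : ℝ) / 2| ≤
      ((A ∩ cutE ends W).card : ℝ) / 2

/-- `φ`-stability of the multidegree `x` on the spanning subgraph `A`. -/
def PhiStable (ends : E → V × V) (φ : V → ℝ) (A : Finset E) (x : V → ℤ) : Prop :=
  ∀ W : Finset V, W.Nonempty → W ≠ Finset.univ →
    |(∑ v ∈ W, ((x v : ℝ) - φ v)) + (((Finset.univ \ A) ∩ inE ends W).card : ℝ) +
        (((Finset.univ \ A) ∩ cutE ends W).card : ℝ) / 2| <
      ((A ∩ cutE ends W).card : ℝ) / 2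

/-- Nondegeneracy of a numerical polarization `φ`. -/
def Nondegenerate (ends : E → V × V) (d : ℤ) (φ : V → ℝ) : Prop :=
  ∀ A : Finset E, ∀ x ∈ Sdeg d A, PhiSemistable ends φ A x → PhiStable ends φ A x

/-- The assignment `stab_{Γ,φ}` associated with a numerical polarization `φ`. -/
def stabAssign (ends : E → V × V) (d : ℤ) (φ : V → ℝ) : Finset E → Set (V → ℤ) :=
  fun A => {x | Conn ends A ∧ x ∈ Sdeg d A ∧ PhiSemistable ends φ A x}

/-- The valence of the vertex `v` (loops counted twice). -/
def valence (ends : E → V × V) (v : V) : ℕ :=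
  ∑ e : E, ((if (ends e).1 = v then 1 else 0) + (if (ends e).2 = v then 1 else 0))

/-- `x` is an integral break divisor for the connected spanning subgraph `A`. -/
def isIBD (ends : E → V × V) (gen : V → ℕ) (A : Finset E) (x : V → ℤ) : Prop :=
  ∃ T : Finset E, T ⊆ A ∧ IsSpanningTree ends T ∧
    ∃ t : E → V, (∀ e ∈ A \ T, t e ∈ eSym ends e) ∧
      x = fun v => (gen v : ℤ) + (((A \ T).filter fun e => t e = v).card : ℤ)

/-- The multidegree `(a, b)` on a two-vertex graph with first vertex `v₁`. -/
def pairFn (v₁ : V) (a b : ℤ) : V → ℤ := fun w => if w = v₁ then a else b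

set_option linter.unusedSectionVars false

/-- The number of edges of `A` joining `v` to a vertex outside `W`. -/
def outDeg (ends : E → V × V) (A : Finset E) (W : Finset V) (v : V) : ℕ :=
  (A.filter fun e => ∃ w ∉ W, eSym ends e = s(v, w)).card

/-- The superstable configurations of the spanning subgraph `A` with sink set `Q`
(the `G`-parking functions of the graph obtained by collapsing `Q` to a point). -/
def superstable (ends : E → V × V) (A : Finset E) (Q : Finset V) : Set (V → ℤ) :=
  {c | (∀ v ∈ Q, c v = 0) ∧ (∀ v, 0 ≤ c v) ∧
    ∀ W : Finset V, W.Nonempty → Disjoint W Q → ∃ v ∈ W, c v < outDeg ends A W v}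

/-- Set the coordinates in `Q` to zero. -/
def killOn (Q : Finset V) (x : V → ℤ) : V → ℤ := fun v => if v ∈ Q then 0 else x v

/-- The Laplacian of the spanning subgraph `A`. -/
def lap (ends : E → V × V) (A : Finset E) (f : V → ℤ) : V → ℤ := fun v =>
  ∑ e ∈ A, (f (ends e).1 - f (ends e).2) * (stdVec (ends e).1 v - stdVec (ends e).2 v)

lemma eSym_eq_iff (ends : E → V × V) (e : E) (v w : V) :
    eSym ends e = s(v, w) ↔
      ((ends e).1 = v ∧ (ends e).2 = w) ∨ ((ends e).1 = w ∧ (ends e).2 = v) := by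
  rw [eSym, Sym2.eq_iff]

lemma superstable_finite (ends : E → V × V) (A : Finset E) (Q : Finset V) :
    (superstable ends A Q).Finite := by
  refine (Set.finite_Icc (0 : V → ℤ) (fun _ => (A.card : ℤ))).subset ?_
  rintro c ⟨h0, hnn, hW⟩
  refine ⟨fun v => hnn v, fun v => ?_⟩
  by_cases hv : v ∈ Q
  · simp [h0 v hv]
  · obtain ⟨w, hw, hlt⟩ := hW {v} (by simp) (by simpa using hv)
    rw [Finset.mem_singleton] at hw
    subst hw
    have : outDeg ends A {w} w ≤ A.card := Finset.card_filter_le _ _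
    show c w ≤ (A.card : ℤ)
    omega

lemma outDeg_le_erase_add_one (ends : E → V × V) (A : Finset E) (e : E) (W : Finset V) (v : V) :
    outDeg ends A W v ≤ outDeg ends (A.erase e) W v + 1 := by
  unfold outDeg
  rw [Finset.filter_erase]
  exact Nat.sub_le_iff_le_add.1 Finset.pred_card_le_card_erase

lemma outDeg_le_erase (ends : E → V × V) (A : Finset E) (e : E) (W : Finset V) (v : V)
    (hv : v ∉ eSym ends e) : outDeg ends A W v ≤ outDeg ends (A.erase e) W v := by
  unfold outDeg
  refine Finset.card_le_card fun f hf => ?_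
  simp only [Finset.mem_filter, Finset.mem_erase] at hf ⊢
  refine ⟨⟨?_, hf.1⟩, hf.2⟩
  rintro rfl
  obtain ⟨w, -, hw⟩ := hf.2
  exact hv (by simp [hw])

/-- Deletion–contraction for superstable configurations along an edge at the sink. -/
lemma superstable_subset (ends : E → V × V) (A : Finset E) (Q : Finset V) (e : E) (q u : V)
    (hq : q ∈ Q) (hu : u ∉ Q) (he : eSym ends e = s(q, u)) :
    superstable ends A Q ⊆ (fun c => c + stdVec u) '' superstable ends (A.erase e) Q ∪
      superstable ends (A.erase e) (insert u Q) := by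
  rintro c ⟨h0, hnn, hW⟩
  have hne : ∀ v, v ∉ Q → v ≠ u → v ∉ eSym ends e := by
    intro v hv hvu
    rw [he, Sym2.mem_iff]
    rintro (rfl | rfl)
    exacts [hv hq, hvu rfl]
  by_cases hcu : c u = 0
  · right
    refine ⟨fun v hv => ?_, hnn, fun W hWn hWQ => ?_⟩
    · rcases Finset.mem_insert.1 hv with rfl | hv
      exacts [hcu, h0 v hv]
    · obtain ⟨v, hv, hlt⟩ := hW W hWn (hWQ.mono_right (Finset.subset_insert _ _))
      have hvQ := Finset.disjoint_left.1 hWQ hv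
      rw [Finset.mem_insert, not_or] at hvQ
      have := outDeg_le_erase ends A e W v (hne v hvQ.2 hvQ.1)
      exact ⟨v, hv, by omega⟩
  · left
    refine ⟨c - stdVec u, ⟨fun v hv => ?_, fun v => ?_, fun W hWn hWQ => ?_⟩, by simp⟩
    · have : v ≠ u := by rintro rfl; exact hu hv
      simp [stdVec, this, h0 v hv]
    · have h1 := hnn v
      by_cases hvu : v = u
      · subst hvu
        simp only [Pi.sub_apply, stdVec, if_true]
        omega
      · simpa [stdVec, hvu] using h1
    · obtain ⟨v, hv, hlt⟩ := hW W hWn hWQ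
      refine ⟨v, hv, ?_⟩
      by_cases hvu : v = u
      · subst hvu
        have := outDeg_le_erase_add_one ends A e W v
        simp only [Pi.sub_apply, stdVec, if_true]
        omega
      · have := outDeg_le_erase ends A e W v (hne v (Finset.disjoint_left.1 hWQ hv) hvu)
        simp only [Pi.sub_apply, stdVec, hvu, if_false]
        omega

/-- A set closed under adding a chip at `u` to the elements of a subset `X` has at least
as many elements as `X` and its own image under forgetting the coordinate `u` together. -/
lemma encard_add_encard_image_le (u : V) (X Z : Set (V → ℤ)) (hX : X ⊆ Z)
    (hXu : ∀ x ∈ X, x + stdVec u ∈ Z) :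
    X.encard + (killOn {u} '' Z).encard ≤ Z.encard := by
  by_cases hZ : Z.Finite
  · have himg : killOn {u} '' Z ⊆ killOn {u} '' (Z \ X) := by
      rintro _ ⟨z, hz, rfl⟩
      obtain ⟨y, ⟨hyZ, hyz⟩, hmax⟩ := Set.exists_max_image
        {y | y ∈ Z ∧ killOn {u} y = killOn {u} z} (fun y => y u)
        (hZ.subset fun y hy => hy.1) ⟨z, hz, rfl⟩
      refine ⟨y, ⟨hyZ, fun hyX => ?_⟩, hyz⟩
      have := hmax (y + stdVec u) ⟨hXu y hyX, by
        rw [← hyz]; funext v; by_cases hv : v = u <;> simp [killOn, stdVec, hv]⟩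
      simp [stdVec] at this
    calc X.encard + (killOn {u} '' Z).encard
        ≤ X.encard + (Z \ X).encard := by
          exact add_le_add le_rfl ((Set.encard_le_encard himg).trans (Set.encard_image_le _ _))
      _ = Z.encard := by rw [add_comm, Set.encard_sdiff_add_encard_of_subset hX]
  · rw [Set.Infinite.encard_eq hZ]
    exact le_top

lemma ChipAdding.nonempty_union {ends : E → V × V} {ρ : Finset E → Set (V → ℤ)}
    (hρ : ChipAdding ends ρ) {B : Finset E} (hB : (ρ B).Nonempty) (A : Finset E) :
    (ρ (A ∪ B)).Nonempty := by
  induction A using Finset.induction_on with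
  | empty => simpa using hB
  | insert e A _ ih =>
    rw [Finset.insert_union]
    by_cases he : e ∈ A ∪ B
    · rwa [Finset.insert_eq_of_mem he]
    · obtain ⟨x, hx⟩ := ih
      exact ⟨_, hρ _ x hx e he (ends e).1 (by simp [eSym])⟩

lemma Linked.mono {ends : E → V × V} {A B : Finset E} (h : A ⊆ B) {v w : V}
    (hl : Linked ends A v w) : Linked ends B v w :=
  Relation.ReflTransGen.mono (fun _ _ ⟨e, he, h'⟩ => ⟨e, h he, h'⟩) _ _ hl

/-- If `B` is a tree on `Q` and `ρ` is closed under chip-adding and nonempty on spanning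
trees, then the image of `ρ (A ∪ B)` away from `Q` has at least as many elements as there are
superstable configurations of `A` with sink `Q`. -/
lemma encard_superstable_le (ends : E → V × V) (ρ : Finset E → Set (V → ℤ))
    (hρ : ChipAdding ends ρ) (hT : ∀ T, IsSpanningTree ends T → (ρ T).Nonempty) (n : ℕ) :
    ∀ (A B : Finset E) (Q : Finset V), A.card = n → Disjoint A B → Q.Nonempty →
      B.card + 1 = Q.card → (∀ v ∈ Q, ∀ w ∈ Q, Linked ends B v w) →
      (superstable ends A Q).encard ≤ (killOn Q '' ρ (A ∪ B)).encard := by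
  induction n with
  | zero => ?_
  | succ n ih => ?_
  all_goals
    intro A B Q hA hAB hQ hcard hlink
  all_goals
    by_cases hcross : ∃ e ∈ A, ∃ q ∈ Q, ∃ u ∉ Q, eSym ends e = s(q, u)
  · obtain ⟨e, he, -⟩ := hcross
    simp [Finset.card_eq_zero.1 hA] at he
  rotate_left
  · obtain ⟨e, heA, q, hq, u, hu, he⟩ := hcross
    have heB : e ∉ B := Finset.disjoint_left.1 hAB heA
    have hA' : (A.erase e).card = n := by rw [Finset.card_erase_of_mem heA, hA]; rfl
    have h1 := ih (A.erase e) B Q hA' (hAB.mono_left (Finset.erase_subset _ _)) hQ hcard hlink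
    have huq : Linked ends (insert e B) q u :=
      Relation.ReflTransGen.single ⟨e, by simp, he⟩
    have hqu : Linked ends (insert e B) u q :=
      Relation.ReflTransGen.single ⟨e, by simp, by rw [he, Sym2.eq_swap]⟩
    have hl : ∀ v ∈ Q, ∀ w ∈ Q, Linked ends (insert e B) v w := fun v hv w hw =>
      (hlink v hv w hw).mono (Finset.subset_insert _ _)
    have h2 := ih (A.erase e) (insert e B) (insert u Q) hA'
      (by
        rw [Finset.disjoint_insert_right]
        exact ⟨by simp, hAB.mono_left (Finset.erase_subset _ _)⟩)
      (by simp)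
      (by rw [Finset.card_insert_of_notMem heB, Finset.card_insert_of_notMem hu, hcard])
      (by
        intro v hv w hw
        rcases Finset.mem_insert.1 hv with hv | hv <;>
          rcases Finset.mem_insert.1 hw with hw | hw
        · rw [hv, hw]
          exact Relation.ReflTransGen.refl
        · rw [hv]
          exact hqu.trans (hl q hq w hw)
        · rw [hw]
          exact (hl v hv q hq).trans huq
        · exact hl v hv w hw)
    have hun : A.erase e ∪ insert e B = A ∪ B := by
      ext f
      by_cases hf : f = e <;> simp [hf, heA]
    have hins : insert e (A.erase e ∪ B) = A ∪ B := by
      rw [← Finset.insert_union, Finset.insert_erase heA]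
    have hnot : e ∉ A.erase e ∪ B := by simp [heB]
    rw [hun] at h2
    have hkill : killOn (insert u Q) '' ρ (A ∪ B) = killOn {u} '' (killOn Q '' ρ (A ∪ B)) := by
      rw [Set.image_image]
      refine Set.image_congr fun x _ => ?_
      funext v
      by_cases hv : v = u <;> simp [killOn, hv]
    have hqe : q ∈ eSym ends e := by simp [he]
    have hue : u ∈ eSym ends e := by simp [he]
    calc (superstable ends A Q).encard
        ≤ ((fun c => c + stdVec u) '' superstable ends (A.erase e) Q).encard +
            (superstable ends (A.erase e) (insert u Q)).encard :=
          (Set.encard_le_encard (superstable_subset ends A Q e q u hq hu he)).trans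
            (Set.encard_union_le _ _)
      _ ≤ (killOn Q '' ρ (A.erase e ∪ B)).encard +
            (killOn {u} '' (killOn Q '' ρ (A ∪ B))).encard := by
          rw [← hkill]
          exact add_le_add ((Set.encard_image_le _ _).trans h1) h2
      _ ≤ (killOn Q '' ρ (A ∪ B)).encard := by
          apply encard_add_encard_image_le
          · rintro _ ⟨x, hx, rfl⟩
            refine ⟨x + stdVec q, hins ▸ hρ _ x hx e hnot q hqe, ?_⟩
            funext v
            by_cases hv : v ∈ Q
            · simp [killOn, hv]
            · have : v ≠ q := by rintro rfl; exact hv hq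
              simp [killOn, hv, stdVec, this]
          · rintro _ ⟨x, hx, rfl⟩
            refine ⟨x + stdVec u, hins ▸ hρ _ x hx e hnot u hue, ?_⟩
            funext v
            by_cases hv : v ∈ Q
            · have : v ≠ u := by rintro rfl; exact hu hv
              simp [killOn, hv, stdVec, this]
            · simp [killOn, hv]
  all_goals
    by_cases hQu : Q = Finset.univ
    · subst hQu
      have hB : IsSpanningTree ends B :=
        ⟨⟨⟨hQ.choose⟩, fun v w => hlink v (by simp) w (by simp)⟩, hcard⟩
      refine le_trans (Set.encard_le_one_iff.2 ?_)
        (Set.one_le_encard_iff_nonempty.2 ((hρ.nonempty_union (hT B hB) A).image _))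
      rintro c c' ⟨hc, -⟩ ⟨hc', -⟩
      funext v
      rw [hc v (by simp), hc' v (by simp)]
    · have : superstable ends A Q = ∅ := by
        rw [Set.eq_empty_iff_forall_notMem]
        rintro c ⟨h0, hnn, hW⟩
        obtain ⟨v, hv, hlt⟩ := hW Qᶜ (by
          rw [Finset.nonempty_iff_ne_empty, Ne, Finset.compl_eq_empty_iff]; exact hQu)
          disjoint_compl_left
        have hz : outDeg ends A Qᶜ v = 0 := by
          rw [outDeg, Finset.card_eq_zero, Finset.filter_eq_empty_iff]
          rintro e he ⟨w, hw, hs⟩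
          exact hcross ⟨e, he, w, by simpa using hw, v, by simpa using hv, by
            rw [hs, Sym2.eq_swap]⟩
        have := hnn v
        omega
      simp [this]

lemma sum_lap_mul (ends : E → V × V) (A : Finset E) (f g : V → ℤ) :
    ∑ v, lap ends A f v * g v =
      ∑ e ∈ A, (f (ends e).1 - f (ends e).2) * (g (ends e).1 - g (ends e).2) := by
  simp only [lap, Finset.sum_mul]
  rw [Finset.sum_comm]
  refine Finset.sum_congr rfl fun e _ => ?_
  simp only [mul_assoc, ← Finset.mul_sum, sub_mul, Finset.sum_sub_distrib, stdVec, ite_mul,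
    one_mul, zero_mul, Finset.sum_ite_eq', Finset.mem_univ, if_true]

lemma sum_lap (ends : E → V × V) (A : Finset E) (f : V → ℤ) : ∑ v, lap ends A f v = 0 := by
  simpa using sum_lap_mul ends A f 1

lemma twVec_eq_lap (ends : E → V × V) (A : Finset E) (v : V) :
    twVec ends A v = -lap ends A (stdVec v) := by
  funext w
  simp only [twVec, lap, Pi.neg_apply, Finset.card_filter, ← Finset.sum_neg_distrib, Nat.cast_sum]
  split_ifs with h
  · subst h
    refine Finset.sum_congr rfl fun e _ => ?_
    simp only [eSym, Sym2.mem_iff, Sym2.mk_isDiag_iff, stdVec]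
    grind
  · refine Finset.sum_congr rfl fun e _ => ?_
    simp only [eSym_eq_iff, stdVec]
    grind

lemma lap_mem_twGroup (ends : E → V × V) (A : Finset E) (f : V → ℤ) :
    lap ends A f ∈ twGroup ends A := by
  have : lap ends A f = ∑ v, f v • -twVec ends A v := by
    funext w
    simp only [twVec_eq_lap, neg_neg, Finset.sum_apply, Pi.smul_apply, lap, smul_eq_mul,
      Finset.mul_sum]
    rw [Finset.sum_comm]
    refine Finset.sum_congr rfl fun e _ => ?_
    have hf : ∀ u, ∑ v, f v * stdVec v u = f u := by simp [stdVec]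
    simp only [← mul_assoc, ← Finset.sum_mul, mul_sub, Finset.sum_sub_distrib, hf]
  rw [this]
  exact sum_mem fun v _ => zsmul_mem (neg_mem (AddSubgroup.subset_closure (Set.mem_range_self v))) _

lemma lap_indicator_of_mem (ends : E → V × V) (A : Finset E) (W : Finset V) (v : V)
    (hv : v ∈ W) : lap ends A (fun w => if w ∈ W then 1 else 0) v = outDeg ends A W v := by
  simp only [lap, outDeg, Finset.card_filter, Nat.cast_sum]
  refine Finset.sum_congr rfl fun e _ => ?_
  have hiff : (∃ w ∉ W, eSym ends e = s(v, w)) ↔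
      ((ends e).1 = v ∧ (ends e).2 ∉ W) ∨ ((ends e).2 = v ∧ (ends e).1 ∉ W) := by
    simp only [eSym_eq_iff]
    grind
  simp only [hiff, stdVec]
  by_cases h1 : v = (ends e).1 <;> by_cases h2 : v = (ends e).2 <;>
    by_cases h3 : (ends e).1 ∈ W <;> by_cases h4 : (ends e).2 ∈ W <;> grind

lemma lap_indicator_of_notMem (ends : E → V × V) (A : Finset E) (W : Finset V) (v : V)
    (hv : v ∉ W) : lap ends A (fun w => if w ∈ W then 1 else 0) v ≤ 0 := by
  refine Finset.sum_nonpos fun e _ => ?_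
  simp only [stdVec]
  grind

/-- A rank function for which every vertex other than `q` has a neighbour of smaller rank. -/
lemma Conn.exists_rank {ends : E → V × V} {A : Finset E} (hA : Conn ends A) (q : V) :
    ∃ r : V → ℕ, r q = 0 ∧ ∀ v ≠ q, ∃ e ∈ A, ∃ w, eSym ends e = s(v, w) ∧ r w < r v := by
  classical
  let P : ℕ → V → Prop := fun n => Nat.rec (motive := fun _ => V → Prop) (fun v => v = q)
    (fun _ R v => ∃ e ∈ A, ∃ w, eSym ends e = s(v, w) ∧ R w) n
  have hP : ∀ v, ∃ n, P n v := fun v => by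
    induction hA.2 q v with
    | refl => exact ⟨0, rfl⟩
    | tail _ h ih =>
      obtain ⟨n, hn⟩ := ih
      obtain ⟨e, he, hs⟩ := h
      exact ⟨n + 1, e, he, _, by rw [hs, Sym2.eq_swap], hn⟩
  refine ⟨fun v => Nat.find (hP v), (Nat.find_eq_zero _).2 rfl, fun v hv => ?_⟩
  have hs := Nat.find_spec (hP v)
  show ∃ e ∈ A, ∃ w, eSym ends e = s(v, w) ∧ Nat.find (hP w) < Nat.find (hP v)
  generalize Nat.find (hP v) = m at hs ⊢
  cases m with
  | zero => exact absurd hs hv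
  | succ n =>
    obtain ⟨e, he, w, hw, hn⟩ := hs
    exact ⟨e, he, w, hw, Nat.lt_succ_of_le (Nat.find_min' _ hn)⟩

/-- A nonnegative function vanishing at `q` and strictly superharmonic elsewhere. -/
lemma Conn.exists_lap_pos {ends : E → V × V} {A : Finset E} (hA : Conn ends A) (q : V) :
    ∃ b : V → ℤ, b q = 0 ∧ (∀ v, 0 ≤ b v) ∧ ∀ v ≠ q, 1 ≤ lap ends A b v := by
  obtain ⟨r, hrq, hr⟩ := hA.exists_rank q
  obtain ⟨n, hn⟩ : ∃ n, ∀ v, r v ≤ n :=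
    ⟨∑ v, r v, fun v => Finset.single_le_sum (fun _ _ => Nat.zero_le _) (Finset.mem_univ v)⟩
  obtain ⟨N, hN⟩ : ∃ N : ℤ, N = A.card + 2 := ⟨_, rfl⟩
  have hN1 : 1 ≤ N := by omega
  have hpos : ∀ k : ℕ, 1 ≤ N ^ k := fun k => one_le_pow₀ hN1
  refine ⟨fun v => N ^ n - N ^ (n - r v), by simp [hrq], fun v => ?_, fun v hv => ?_⟩
  · exact sub_nonneg.2 (pow_le_pow_right₀ hN1 (Nat.sub_le _ _))
  obtain ⟨e, he, w, hs, hw⟩ := hr v hv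
  set M := N ^ (n - r v) with hM
  have hstep : N * M ≤ N ^ (n - r w) := by
    rw [hM, ← pow_succ']
    have := hn v
    exact pow_le_pow_right₀ hN1 (by omega)
  have hvw : v ≠ w := by rintro rfl; omega
  let F : E → ℤ := fun e => ((N ^ n - N ^ (n - r (ends e).1)) - (N ^ n - N ^ (n - r (ends e).2))) *
    (stdVec (ends e).1 v - stdVec (ends e).2 v) + M
  have hF0 : ∀ e ∈ A, 0 ≤ F e := by
    intro e _
    have h1 := hpos (n - r (ends e).1)
    have h2 := hpos (n - r (ends e).2)
    have h3 := hpos (n - r v)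
    simp only [F, stdVec]
    split_ifs with ha hb hb
    · simp; omega
    · rw [← ha, ← hM]; linarith
    · rw [← hb, ← hM]; linarith
    · simp; omega
  have hFe : N * M ≤ F e := by
    simp only [F, stdVec]
    rcases (eSym_eq_iff ends e v w).1 hs with ⟨h1, h2⟩ | ⟨h1, h2⟩ <;>
      simp only [h1, h2, hvw, if_true, if_false, ← hM] <;> linarith
  have hsum : N * M ≤ ∑ e ∈ A, F e := hFe.trans (Finset.single_le_sum hF0 he)
  have hlap : ∑ e ∈ A, F e = lap ends A (fun v => N ^ n - N ^ (n - r v)) v + A.card * M := by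
    simp only [F, lap, Finset.sum_add_distrib, Finset.sum_const, nsmul_eq_mul]
  have hM1 : 1 ≤ M := hpos _
  have hNM : N * M = A.card * M + 2 * M := by rw [hN]; ring
  rw [hlap, hNM] at hsum
  linarith

/-- Every multidegree is chip-firing equivalent to one that is superstable away from `q`. -/
lemma Conn.exists_superstable {ends : E → V × V} {A : Finset E} (hA : Conn ends A) (q : V)
    (x : V → ℤ) : ∃ y, x - y ∈ twGroup ends A ∧ ∑ v, y v = ∑ v, x v ∧
      killOn {q} y ∈ superstable ends A {q} := by
  obtain ⟨b, hbq, hb0, hb⟩ := hA.exists_lap_pos q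
  have hne : ∃ k : ℕ, ∃ f : V → ℤ, (∀ v ≠ q, 0 ≤ (x - lap ends A f) v) ∧
      ∑ v, (x - lap ends A f) v * b v ≤ k := by
    obtain ⟨m, hm⟩ : ∃ m : ℤ, ∀ v, |x v| ≤ m :=
      ⟨∑ v, |x v|, fun v => Finset.single_le_sum (f := fun v => |x v|)
        (fun _ _ => abs_nonneg _) (Finset.mem_univ v)⟩
    refine ⟨_, fun v => -m * b v, fun v hv => ?_, Int.self_le_toNat _⟩
    have h1 : lap ends A (fun v => -m * b v) v = -m * lap ends A b v := by
      simp only [lap, Finset.mul_sum]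
      exact Finset.sum_congr rfl fun e _ => by ring
    have h2 := hb v hv
    have h3 := neg_abs_le (x v)
    have h4 := hm v
    have h5 := abs_nonneg (x v)
    rw [Pi.sub_apply, h1]
    nlinarith
  classical
  obtain ⟨f, hf, hle⟩ := Nat.find_spec hne
  have hmin := fun m => Nat.find_min hne (m := m)
  generalize Nat.find hne = k at hle hmin
  refine ⟨x - lap ends A f, by simpa using lap_mem_twGroup ends A f, ?_, ?_, ?_, ?_⟩
  · simp [Finset.sum_sub_distrib, sum_lap]
  · intro v hv
    simp [killOn, Finset.mem_singleton.1 hv]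
  · intro v
    by_cases hv : v = q
    · simp [killOn, hv]
    · simpa [killOn, hv] using hf v hv
  · intro W hWn hWq
    by_contra! hbad
    rw [Finset.disjoint_singleton_right] at hWq
    let g : V → ℤ := fun w => if w ∈ W then 1 else 0
    have hadd : ∀ v, (x - lap ends A (f + g)) v = (x - lap ends A f) v - lap ends A g v := by
      intro v
      have : lap ends A (f + g) v = lap ends A f v + lap ends A g v := by
        simp only [lap, ← Finset.sum_add_distrib, Pi.add_apply]
        exact Finset.sum_congr rfl fun e _ => by ring
      rw [Pi.sub_apply, Pi.sub_apply, this]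
      ring
    have hnn : ∀ v ≠ q, 0 ≤ (x - lap ends A (f + g)) v := by
      intro v hv
      rw [hadd]
      by_cases hvW : v ∈ W
      · have h1 := hbad v hvW
        simp only [killOn, Finset.mem_singleton, hv, if_false] at h1
        rw [lap_indicator_of_mem ends A W v hvW]
        linarith
      · have h1 := lap_indicator_of_notMem ends A W v hvW
        have h2 := hf v hv
        simp only [g]
        linarith
    have hsym : ∑ v, lap ends A g v * b v = ∑ v ∈ W, lap ends A b v := by
      have : ∑ v, lap ends A g v * b v = ∑ v, lap ends A b v * g v := by
        rw [sum_lap_mul, sum_lap_mul]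
        exact Finset.sum_congr rfl fun e _ => mul_comm _ _
      rw [this]
      simp [g]
    have hge : 1 ≤ ∑ v ∈ W, lap ends A b v := by
      obtain ⟨w, hw⟩ := hWn
      have hWne : ∀ v ∈ W, 1 ≤ lap ends A b v := fun v hv =>
        hb v (by rintro rfl; exact hWq hv)
      exact (hWne w hw).trans (Finset.single_le_sum
        (fun v hv => zero_le_one.trans (hWne v hv)) hw)
    have hs : ∑ v, (x - lap ends A (f + g)) v * b v ≤ (k : ℤ) - 1 := by
      have : ∑ v, (x - lap ends A (f + g)) v * b v =
          ∑ v, (x - lap ends A f) v * b v - ∑ v, lap ends A g v * b v := by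
        rw [← Finset.sum_sub_distrib]
        exact Finset.sum_congr rfl fun v _ => by rw [hadd]; ring
      rw [this, hsym]
      linarith
    have h0 : 0 ≤ ∑ v, (x - lap ends A (f + g)) v * b v := by
      refine Finset.sum_nonneg fun v _ => ?_
      by_cases hv : v = q
      · simp [hv, hbq]
      · exact mul_nonneg (hnn v hv) (hb0 v)
    exact hmin (k - 1) (by omega) ⟨f + g, hnn, by omega⟩

/-- A set of representatives for chip-firing has at most as many elements as there are
superstable configurations. -/
lemma IsRepSet.encard_le {ends : E → V × V} {d : ℤ} {A : Finset E} {S : Set (V → ℤ)}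
    (hS : IsRepSet ends d A S) (hA : Conn ends A) (q : V) :
    S.encard ≤ (superstable ends A {q}).encard := by
  choose y hy hsum hsup using fun x => hA.exists_superstable q x
  refine Set.encard_le_encard_of_injOn (f := fun x => killOn {q} (y x)) (fun x _ => hsup x) ?_
  intro x hx x' hx' heq
  have hoff : ∀ v ≠ q, y x v = y x' v := fun v hv => by
    simpa [killOn, hv] using congrFun heq v
  have hyy : y x = y x' := by
    funext v
    by_cases hv : v = q
    · have h1 : ∑ v, y x v = ∑ v, y x' v := by
        have h2 : ∑ v, x v = d - (nG A : ℤ) := hS.1 hx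
        have h3 : ∑ v, x' v = d - (nG A : ℤ) := hS.1 hx'
        rw [hsum, hsum, h2, h3]
      rw [← Finset.add_sum_erase _ _ (Finset.mem_univ q),
        ← Finset.add_sum_erase _ (y x') (Finset.mem_univ q),
        Finset.sum_congr rfl fun v hv => hoff v (Finset.ne_of_mem_erase hv)] at h1
      rw [hv]
      linarith
    · exact hoff v hv
  have hmem : x - x' ∈ twGroup ends A := by
    have := sub_mem (hy x) (hy x')
    rwa [hyy, sub_sub_sub_cancel_right] at this
  exact (hS.2 x (hS.1 hx)).unique ⟨hx, by simp⟩ ⟨hx', hmem⟩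

/-- A stability assignment agrees with any chip-adding subassignment that is nonempty on
spanning trees. -/
lemma IsStabilityAssignment.eq_of_subset {ends : E → V × V} {d : ℤ}
    {σ ρ : Finset E → Set (V → ℤ)} (hσ : IsStabilityAssignment ends d σ)
    (hρ : ChipAdding ends ρ) (hT : ∀ T, IsSpanningTree ends T → (ρ T).Nonempty)
    (hsub : ∀ A, ρ A ⊆ σ A) : ρ = σ := by
  funext A
  by_cases hA : Conn ends A
  · obtain ⟨q⟩ := hA.1
    have h1 := (hσ.2.2 A hA).encard_le hA q
    have h2 := encard_superstable_le ends ρ hρ hT A.card A ∅ {q} rfl (by simp) (by simp)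
      (by simp) (by
        intro v hv w hw
        rw [Finset.mem_singleton.1 hv, Finset.mem_singleton.1 hw]
        exact Relation.ReflTransGen.refl)
    rw [Finset.union_empty] at h2
    have hfin : (σ A).Finite := Set.encard_lt_top_iff.1
      (h1.trans_lt (superstable_finite ends A {q}).encard_lt_top)
    exact (hfin.subset (hsub A)).eq_of_subset_of_encard_le (hsub A)
      (h1.trans (h2.trans (Set.encard_image_le (killOn {q}) (ρ A))))
  · have h : σ A = ∅ := Set.eq_empty_iff_forall_notMem.2 fun x hx => hA (hσ.1 A x hx).1
    rw [h, Set.subset_eq_empty (hsub A) h]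

/-- Fixing a multidegree `dT T ∈ S^d_Γ(T)` for every spanning tree `T`
of a connected multigraph `Γ`, there is at most one degree-`d` stability assignment `σ`
with `σ(T) = {dT T}` for all spanning trees `T`. -/
theorem statement3 (ends : E → V × V) (d : ℤ)
    (hconn : Conn ends (Finset.univ : Finset E))
    (dT : Finset E → V → ℤ)
    (hdT : ∀ T : Finset E, IsSpanningTree ends T → dT T ∈ Sdeg d T)
    (σ τ : Finset E → Set (V → ℤ))
    (hσ : IsStabilityAssignment ends d σ) (hτ : IsStabilityAssignment ends d τ)
    (hσT : ∀ T : Finset E, IsSpanningTree ends T → σ T = {dT T})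
    (hτT : ∀ T : Finset E, IsSpanningTree ends T → τ T = {dT T}) :
    σ = τ := by
  have hchip : ChipAdding ends fun A => σ A ∩ τ A := fun A x hx e he v hv =>
    ⟨hσ.2.1 A x hx.1 e he v hv, hτ.2.1 A x hx.2 e he v hv⟩
  have hne : ∀ T, IsSpanningTree ends T → (σ T ∩ τ T).Nonempty := fun T hT =>
    ⟨dT T, by rw [hσT T hT, hτT T hT]; simp⟩
  rw [← hσ.eq_of_subset hchip hne fun _ => Set.inter_subset_left]
  exact hτ.eq_of_subset hchip hne fun _ => Set.inter_subset_right
end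

section
/- Let Γ be a finite connected multigraph and let σ be a degree-d assignment for Γ that satisfies condition (1) (chip-adding) and such that σ(T) ≠ ∅ for every spanning tree T of Γ. Then |σ(G)| ≥ c(G) for every spanning subgraph G of Γ. Moreover, if |σ(Γ)| = c(Γ), then |σ(G)| = c(G) for every spanning subgraph G of Γ. -/
open Finset

variable {V E : Type} [Fintype V] [Fintype E] [DecidableEq V] [DecidableEq E]

set_option linter.unusedSectionVars false

theorem Linked.symm {ends : E → V × V} {A : Finset E} {v w : V}
    (h : Linked ends A v w) : Linked ends A w v :=
  have : Std.Symm fun v w => ∃ e ∈ A, eSym ends e = s(v, w) :=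
    ⟨fun _ _ ⟨e, he, h⟩ => ⟨e, he, by rw [h, Sym2.eq_swap]⟩⟩
  Relation.ReflTransGen.stdSymm.symm _ _ h

theorem Linked.of_mem {ends : E → V × V} {A : Finset E} {e : E} {v w : V}
    (he : e ∈ A) (h : eSym ends e = s(v, w)) : Linked ends A v w :=
  Relation.ReflTransGen.single ⟨e, he, h⟩

theorem conn_of_conn_insert_loop {ends : E → V × V} {B : Finset E} {e : E}
    (he : (eSym ends e).IsDiag) (h : Conn ends (insert e B)) : Conn ends B := by
  refine ⟨h.1, fun v w => ?_⟩
  have h2 : Linked ends (insert e B) v w := h.2 v w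
  induction h2 with
  | refl => exact .refl
  | tail _ hbc ih =>
    obtain ⟨e', he', hs⟩ := hbc
    rcases Finset.mem_insert.1 he' with rfl | hB
    · rw [hs, Sym2.mk_isDiag_iff] at he
      exact he ▸ ih
    · exact ih.tail ⟨e', hB, hs⟩

/-- The retraction of the vertex set that merges `b` into `a`. -/
def mergeVertex {a b : V} (hab : a ≠ b) (v : V) : {v : V // v ≠ b} :=
  if h : v = b then ⟨a, hab⟩ else ⟨v, h⟩

theorem mergeVertex_coe {a b : V} (hab : a ≠ b) (v : {v : V // v ≠ b}) :
    mergeVertex hab v = v := by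
  simp [mergeVertex, v.2]

theorem mergeVertex_left {a b : V} (hab : a ≠ b) : mergeVertex hab a = ⟨a, hab⟩ := by
  simp [mergeVertex, hab]

theorem mergeVertex_right {a b : V} (hab : a ≠ b) : mergeVertex hab b = ⟨a, hab⟩ := by
  simp [mergeVertex]

/-- The endpoints of the edges after merging the vertex `b` into `a`. -/
def mergeEnds (ends : E → V × V) {a b : V} (hab : a ≠ b) (e : E) :
    {v : V // v ≠ b} × {v : V // v ≠ b} :=
  (mergeVertex hab (ends e).1, mergeVertex hab (ends e).2)

theorem eSym_mergeEnds (ends : E → V × V) {a b : V} (hab : a ≠ b) (e : E) :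
    eSym (mergeEnds ends hab) e = (eSym ends e).map (mergeVertex hab) := rfl

theorem card_ne_add_one (b : V) : Fintype.card {v : V // v ≠ b} + 1 = Fintype.card V := by
  have : 0 < Fintype.card V := Fintype.card_pos_iff.2 ⟨b⟩
  rw [Fintype.card_subtype_compl, Fintype.card_subtype_eq]
  omega

theorem conn_mergeEnds_iff {ends : E → V × V} {a b : V} (hab : a ≠ b) {e : E}
    (he : eSym ends e = s(a, b)) (B : Finset E) :
    Conn (mergeEnds ends hab) B ↔ Conn ends (insert e B) := by
  constructor
  · rintro ⟨-, h⟩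
    have retract (v : V) : Linked ends (insert e B) v (mergeVertex hab v) := by
      by_cases hv : v = b
      · subst hv
        rw [mergeVertex_right]
        exact (Linked.of_mem (Finset.mem_insert_self e B) he).symm
      · simp only [mergeVertex, hv, dite_false]
        exact .refl
    have lift {x y : {v : V // v ≠ b}} (hxy : Linked (mergeEnds ends hab) B x y) :
        Linked ends (insert e B) (x : V) y := by
      induction hxy with
      | refl => exact .refl
      | @tail y z _ hbc ih =>
        refine ih.trans ?_
        obtain ⟨e', he', hs⟩ := hbc
        have hlink : Linked ends (insert e B) (mergeVertex hab (ends e').1 : V)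
            (mergeVertex hab (ends e').2) :=
          (retract _).symm.trans
            ((Linked.of_mem (Finset.mem_insert_of_mem he') rfl).trans (retract _))
        rcases Sym2.eq_iff.1 hs with ⟨h1, h2⟩ | ⟨h1, h2⟩
        · rw [← h1, ← h2]; exact hlink
        · rw [← h1, ← h2]; exact hlink.symm
    exact ⟨⟨a⟩, fun v w => (retract v).trans ((lift (h _ _)).trans (retract w).symm)⟩
  · rintro ⟨-, h⟩
    refine ⟨⟨⟨a, hab⟩⟩, fun x y => ?_⟩
    have push {v w : V} (hvw : Linked ends (insert e B) v w) :
        Linked (mergeEnds ends hab) B (mergeVertex hab v) (mergeVertex hab w) := by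
      induction hvw with
      | refl => exact .refl
      | tail _ hbc ih =>
        obtain ⟨e', he', hs⟩ := hbc
        rcases Finset.mem_insert.1 he' with rfl | hB
        · rw [he] at hs
          rcases Sym2.eq_iff.1 hs with ⟨rfl, rfl⟩ | ⟨rfl, rfl⟩
          · rwa [mergeVertex_right, ← mergeVertex_left hab]
          · rwa [mergeVertex_left, ← mergeVertex_right hab]
        · exact ih.tail ⟨e', hB, by rw [eSym_mergeEnds, hs, Sym2.map_mk]⟩
    simpa only [mergeVertex_coe] using push (h x y)

theorem isSpanningTree_mergeEnds_iff {ends : E → V × V} {a b : V} (hab : a ≠ b) {e : E}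
    (he : eSym ends e = s(a, b)) {B : Finset E} (heB : e ∉ B) :
    IsSpanningTree (mergeEnds ends hab) B ↔ IsSpanningTree ends (insert e B) := by
  rw [IsSpanningTree, IsSpanningTree, conn_mergeEnds_iff hab he,
    Finset.card_insert_of_notMem heB, ← card_ne_add_one b, Nat.add_right_cancel_iff]

theorem Conn.card_le (A : Finset E) : ∀ {V : Type} [Fintype V] [DecidableEq V]
    {ends : E → V × V}, Conn ends A → Fintype.card V ≤ A.card + 1 := by
  induction A using Finset.induction_on with
  | empty =>
    intro V _ _ ends h
    have : Subsingleton V := ⟨fun v w => by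
      have h2 : Linked ends ∅ v w := h.2 v w
      induction h2 with
      | refl => rfl
      | tail _ hbc _ => simp at hbc⟩
    simpa using Fintype.card_le_one_iff_subsingleton.2 this
  | insert e B heB ih =>
    intro V _ _ ends h
    rw [Finset.card_insert_of_notMem heB]
    by_cases hab : (ends e).1 = (ends e).2
    · exact (ih (conn_of_conn_insert_loop hab h)).trans (Nat.le_succ _)
    · rw [← card_ne_add_one (ends e).2]
      exact Nat.succ_le_succ (ih ((conn_mergeEnds_iff hab rfl B).2 h))

theorem IsSpanningTree.not_isDiag {ends : E → V × V} {T : Finset E}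
    (hT : IsSpanningTree ends T) {e : E} (he : e ∈ T) : ¬ (eSym ends e).IsDiag := by
  intro hd
  have hc := Conn.card_le (T.erase e)
    (conn_of_conn_insert_loop hd (by rw [Finset.insert_erase he]; exact hT.1))
  have h2 := hT.2
  have := Finset.card_erase_add_one he
  omega

open Classical in
theorem complexity_eq_card_filter (ends : E → V × V) (A : Finset E) :
    complexity ends A = (A.powerset.filter (IsSpanningTree ends)).card := by
  rw [complexity, Nat.card_eq_fintype_card, Fintype.card_subtype]
  congr 1
  ext T
  simp

theorem complexity_le_erase_of_isDiag {ends : E → V × V} (A : Finset E) {e : E}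
    (he : (eSym ends e).IsDiag) : complexity ends A ≤ complexity ends (A.erase e) := by
  classical
  rw [complexity_eq_card_filter, complexity_eq_card_filter]
  refine Finset.card_le_card fun T hT => ?_
  simp only [Finset.mem_filter, Finset.mem_powerset] at hT ⊢
  exact ⟨Finset.subset_erase.2 ⟨hT.1, fun h => hT.2.not_isDiag h he⟩, hT.2⟩

theorem complexity_le_erase_add_mergeEnds {ends : E → V × V} (A : Finset E) {a b : V}
    (hab : a ≠ b) {e : E} (he : eSym ends e = s(a, b)) :
    complexity ends A ≤
      complexity ends (A.erase e) + complexity (mergeEnds ends hab) (A.erase e) := by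
  classical
  simp only [complexity_eq_card_filter]
  rw [← Finset.card_filter_add_card_filter_not (s := A.powerset.filter _) (fun T => e ∉ T)]
  refine Nat.add_le_add (Finset.card_le_card fun T hT => ?_)
    (Finset.card_le_card_of_injOn (fun T => T.erase e) (fun T hT => ?_) fun S hS T hT h => ?_)
  · simp only [Finset.mem_filter, Finset.mem_powerset] at hT ⊢
    exact ⟨Finset.subset_erase.2 ⟨hT.1.1, hT.2⟩, hT.1.2⟩
  · simp only [Finset.coe_filter, Finset.mem_filter, Finset.mem_powerset, not_not,
      Set.mem_ofPred_eq] at hT ⊢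
    refine ⟨Finset.erase_subset_erase e hT.1.1, ?_⟩
    rw [isSpanningTree_mergeEnds_iff hab he (Finset.notMem_erase e T),
      Finset.insert_erase hT.2]
    exact hT.1.2
  · simp only [Finset.coe_filter, Finset.mem_filter, not_not, Set.mem_ofPred_eq] at hS hT
    rw [← Finset.insert_erase hS.2, ← Finset.insert_erase hT.2]
    exact congrArg (insert e) h

/-- The multidegree obtained by summing over the fibres of a map of vertices. -/
def pushDeg {W : Type} [DecidableEq W] (p : V → W) (x : V → ℤ) : W → ℤ :=
  fun w => ∑ v, if p v = w then x v else 0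

theorem pushDeg_add_stdVec {W : Type} [DecidableEq W] (p : V → W) (x : V → ℤ) (v : V) :
    pushDeg p (x + stdVec v) = pushDeg p x + stdVec (p v) := by
  funext w
  have h : ∀ u, (if p u = w then (x + stdVec v) u else 0) =
      (if p u = w then x u else 0) + if u = v then (if p v = w then 1 else 0) else 0 := by
    intro u
    by_cases hu : u = v
    · subst hu
      by_cases hp : p u = w <;> simp [hp, stdVec]
    · simp [stdVec, hu]
  rw [pushDeg, Finset.sum_congr rfl fun u _ => h u, Finset.sum_add_distrib]
  simp [pushDeg, stdVec, eq_comm]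

theorem encard_add_encard_pushDeg_le {W : Type} [DecidableEq W] (p : V → W) {a b : V}
    (hab : a ≠ b) (hp : p a = p b) {S X : Set (V → ℤ)}
    (ha : ∀ x ∈ S, x + stdVec a ∈ X) (hb : ∀ x ∈ S, x + stdVec b ∈ X) :
    S.encard + (pushDeg p '' X).encard ≤ X.encard := by
  rcases X.finite_or_infinite with hX | hX
  swap
  · simp [hX.encard_eq]
  set S' := (fun x => x + stdVec b) '' S with hS'
  have hsub : S' ⊆ X := Set.image_subset_iff.2 hb
  have himage : pushDeg p '' X ⊆ pushDeg p '' (X \ S') := by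
    rintro _ ⟨x, hx, rfl⟩
    obtain ⟨y, ⟨hyX, hyx⟩, hmax⟩ := Set.exists_max_image
      {y | y ∈ X ∧ pushDeg p y = pushDeg p x} (fun y => y a)
      (hX.subset fun y hy => hy.1) ⟨x, hx, rfl⟩
    refine ⟨y, ⟨hyX, ?_⟩, hyx⟩
    rintro ⟨s, hs, rfl⟩
    have := hmax (s + stdVec a) ⟨ha s hs, by
      rw [← hyx, pushDeg_add_stdVec, pushDeg_add_stdVec, hp]⟩
    simp [stdVec, hab] at this
  calc S.encard + (pushDeg p '' X).encard ≤ S'.encard + (X \ S').encard := by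
        rw [hS', (add_left_injective (stdVec b)).encard_image]
        gcongr
        exact (Set.encard_le_encard himage).trans (Set.encard_image_le _ _)
    _ = X.encard := by rw [add_comm, Set.encard_sdiff_add_encard_of_subset hsub]

/-- Chip-adding together with nonemptiness on spanning trees, for subgraphs of `A` only. -/
structure IsTreeSupportedOn (ends : E → V × V) (A : Finset E)
    (σ : Finset E → Set (V → ℤ)) : Prop where
  chip : ∀ B ⊆ A, ∀ x ∈ σ B, ∀ e ∈ A, e ∉ B → ∀ v ∈ eSym ends e, x + stdVec v ∈ σ (insert e B)
  nonempty : ∀ T ⊆ A, IsSpanningTree ends T → (σ T).Nonempty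

theorem IsTreeSupportedOn.mono {ends : E → V × V} {A B : Finset E}
    {σ : Finset E → Set (V → ℤ)} (h : IsTreeSupportedOn ends A σ) (hBA : B ⊆ A) :
    IsTreeSupportedOn ends B σ :=
  ⟨fun C hC x hx e he => h.chip C (hC.trans hBA) x hx e (hBA he),
    fun T hTB => h.nonempty T (hTB.trans hBA)⟩

theorem IsTreeSupportedOn.chip_erase {ends : E → V × V} {A : Finset E}
    {σ : Finset E → Set (V → ℤ)} (h : IsTreeSupportedOn ends A σ) {e : E} (heA : e ∈ A)
    {v : V} (hv : v ∈ eSym ends e) : ∀ x ∈ σ (A.erase e), x + stdVec v ∈ σ A := by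
  intro x hx
  have := h.chip _ (Finset.erase_subset e A) x hx e heA (Finset.notMem_erase e A) v hv
  rwa [Finset.insert_erase heA] at this

theorem IsTreeSupportedOn.mergeEnds {ends : E → V × V} {A : Finset E}
    {σ : Finset E → Set (V → ℤ)} (h : IsTreeSupportedOn ends A σ) {a b : V} (hab : a ≠ b)
    {e : E} (heA : e ∈ A) (he : eSym ends e = s(a, b)) :
    IsTreeSupportedOn (mergeEnds ends hab) (A.erase e)
      (fun B => pushDeg (mergeVertex hab) '' σ (insert e B)) := by
  constructor
  · rintro B hB _ ⟨x, hx, rfl⟩ e' he' heB' v' hv'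
    rw [eSym_mergeEnds, Sym2.mem_map] at hv'
    obtain ⟨v, hv, rfl⟩ := hv'
    obtain ⟨hne, heA'⟩ := Finset.mem_erase.1 he'
    refine ⟨x + stdVec v, ?_, pushDeg_add_stdVec _ _ _⟩
    rw [Finset.insert_comm]
    exact h.chip _ (Finset.insert_subset heA (hB.trans (Finset.erase_subset e A))) x hx e' heA'
      (by simp [hne, heB']) v hv
  · intro T hTA hT
    have heT : e ∉ T := fun h => Finset.notMem_erase e A (hTA h)
    exact (h.nonempty (insert e T)
      (Finset.insert_subset heA (hTA.trans (Finset.erase_subset e A)))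
      ((isSpanningTree_mergeEnds_iff hab he heT).1 hT)).image _

/-- If the complexity bound is known for subgraphs with edge set `A.erase e`, then deleting `e`
decreases the complexity by at most `k` and the size of the assignment by at least `k`,
for a suitable `k`. -/
theorem IsTreeSupportedOn.exists_deletion_bound {ends : E → V × V} {A : Finset E}
    {σ : Finset E → Set (V → ℤ)} (h : IsTreeSupportedOn ends A σ) {e : E} (heA : e ∈ A)
    (bound : ∀ {W : Type} [Fintype W] [DecidableEq W] {ends' : E → W × W}
      {τ : Finset E → Set (W → ℤ)}, IsTreeSupportedOn ends' (A.erase e) τ →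
        (complexity ends' (A.erase e) : ℕ∞) ≤ (τ (A.erase e)).encard) :
    ∃ k : ℕ, complexity ends A ≤ complexity ends (A.erase e) + k ∧
      (σ (A.erase e)).encard + k ≤ (σ A).encard := by
  by_cases hab : (ends e).1 = (ends e).2
  · refine ⟨0, complexity_le_erase_of_isDiag A hab, ?_⟩
    rw [Nat.cast_zero, add_zero, ← (add_left_injective (stdVec (ends e).1)).encard_image]
    exact Set.encard_le_encard
      (Set.image_subset_iff.2 (h.chip_erase heA (Sym2.mem_mk_left _ _)))
  · refine ⟨_, complexity_le_erase_add_mergeEnds A hab rfl, ?_⟩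
    have hmerge := bound (h.mergeEnds hab heA rfl)
    rw [Finset.insert_erase heA] at hmerge
    exact (add_le_add_right hmerge _).trans (encard_add_encard_pushDeg_le (mergeVertex hab) hab
      ((mergeVertex_left hab).trans (mergeVertex_right hab).symm)
      (h.chip_erase heA (Sym2.mem_mk_left _ _)) (h.chip_erase heA (Sym2.mem_mk_right _ _)))

theorem IsTreeSupportedOn.complexity_le_encard (A : Finset E) :
    ∀ {V : Type} [Fintype V] [DecidableEq V] {ends : E → V × V}
      {σ : Finset E → Set (V → ℤ)}, IsTreeSupportedOn ends A σ →
        (complexity ends A : ℕ∞) ≤ (σ A).encard := by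
  induction A using Finset.induction_on with
  | empty =>
    intro V _ _ ends σ h
    classical
    rw [complexity_eq_card_filter, Finset.powerset_empty, Finset.filter_singleton]
    split_ifs with hT
    · simpa using h.nonempty ∅ subset_rfl hT
    · simp
  | insert e B heB ih =>
    intro V _ _ ends σ h
    obtain ⟨k, hk, hσ⟩ := h.exists_deletion_bound (Finset.mem_insert_self e B)
      (by rw [Finset.erase_insert heB]; exact ih)
    rw [Finset.erase_insert heB] at hk hσ
    calc (complexity ends (insert e B) : ℕ∞) ≤ complexity ends B + k := by exact_mod_cast hk
      _ ≤ (σ B).encard + k := by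
        gcongr
        exact ih (h.mono (Finset.subset_insert e B))
      _ ≤ _ := hσ

theorem IsTreeSupportedOn.encard_erase_le {ends : E → V × V} {A : Finset E}
    {σ : Finset E → Set (V → ℤ)} (h : IsTreeSupportedOn ends A σ) {e : E} (heA : e ∈ A)
    (hle : (σ A).encard ≤ complexity ends A) :
    (σ (A.erase e)).encard ≤ complexity ends (A.erase e) := by
  obtain ⟨k, hk, hσ⟩ := h.exists_deletion_bound heA
    (IsTreeSupportedOn.complexity_le_encard (A.erase e))
  refine (ENat.add_le_add_iff_right (ENat.natCast_ne_top k)).1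
    (hσ.trans (hle.trans ?_))
  exact_mod_cast hk

/-- If a degree-`d` assignment `σ` for a connected multigraph `Γ`
satisfies chip-adding and `σ(T) ≠ ∅` for every spanning tree `T`, then
`|σ(G)| ≥ c(G)` for every spanning subgraph `G`; moreover if `|σ(Γ)| = c(Γ)` then
`|σ(G)| = c(G)` for every spanning subgraph `G`. -/
theorem statement4 (ends : E → V × V) (d : ℤ) (σ : Finset E → Set (V → ℤ))
    (hconn : Conn ends (Finset.univ : Finset E))
    (hassign : IsAssignment ends d σ) (hchip : ChipAdding ends σ)
    (hT : ∀ T : Finset E, IsSpanningTree ends T → (σ T).Nonempty) :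
    (∀ G : Finset E, (complexity ends G : ℕ∞) ≤ (σ G).encard) ∧
      ((σ (Finset.univ : Finset E)).encard =
          (complexity ends (Finset.univ : Finset E) : ℕ∞) →
        ∀ G : Finset E, (σ G).encard = (complexity ends G : ℕ∞)) := by
  have hσ : IsTreeSupportedOn ends Finset.univ σ :=
    ⟨fun B _ x hx e _ => hchip B x hx e, fun T _ => hT T⟩
  have lower (G : Finset E) : (complexity ends G : ℕ∞) ≤ (σ G).encard :=
    (hσ.mono (Finset.subset_univ G)).complexity_le_encard
  refine ⟨lower, fun hΓ G => le_antisymm ?_ (lower G)⟩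
  suffices H : ∀ D : Finset E,
      (σ (Finset.univ \ D)).encard ≤ complexity ends (Finset.univ \ D) by
    simpa using H (Finset.univ \ G)
  intro D
  induction D using Finset.induction_on with
  | empty => simpa using hΓ.le
  | insert e D he ih =>
    rw [Finset.sdiff_insert]
    exact (hσ.mono (Finset.subset_univ _)).encard_erase_le (by simp [he]) ih
end

section
/- Let Γ be the multigraph with two vertices v₁, v₂ joined by t ≥ 1 edges and no other edges, and write multidegrees 𝐝 ∈ ℤ^{Verts(Γ)} as pairs (𝐝(v₁), 𝐝(v₂)). The spanning trees of Γ are the subgraphs Γ₁, …, Γ_t with a single edge. Then for every degree-d stability assignment σ for Γ there exists a unique integer λ such that: (i) σ(Γ_i) = {(λ, d+1−λ−t)} for every i = 1, …, t; and (ii) σ(Γ) = {(λ, d−λ), (λ+1, d−λ−1), …, (λ+t−1, d+1−λ−t)}. -/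
open Finset

variable {V E : Type} [Fintype V] [Fintype E] [DecidableEq V] [DecidableEq E]

/-- If the sets `S A` are complete sets of residues modulo `#A` and `S A ∪ (S A + 1)` is contained in
`S (insert e A)` for `e ∉ A`, then all `S A` are integer intervals with a common left end. -/
theorem exists_eq_Ico_of_residues {E : Type} [Fintype E] [DecidableEq E] [Nonempty E]
    {S : Finset E → Set ℤ}
    (hadd : ∀ A, ∀ a ∈ S A, ∀ e ∉ A, a ∈ S (insert e A) ∧ a + 1 ∈ S (insert e A))
    (hres : ∀ A : Finset E, A.Nonempty → ∀ a, ∃! b, b ∈ S A ∧ (#A : ℤ) ∣ a - b) :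
    ∃ l : ℤ, ∀ A : Finset E, A.Nonempty → S A = Set.Ico l (l + #A) := by
  have eq_of_subset : ∀ (A : Finset E) (l : ℤ), A.Nonempty →
      Set.Ico l (l + #A) ⊆ S A → S A = Set.Ico l (l + #A) := by
    intro A l hA hsub
    refine Set.Subset.antisymm (fun y hy => ?_) hsub
    have hpos : (0 : ℤ) < #A := by exact_mod_cast hA.card_pos
    have hlo := Int.emod_nonneg (y - l) hpos.ne'
    have hhi := Int.emod_lt_of_pos (y - l) hpos
    have hmem : l + (y - l) % #A ∈ Set.Ico l (l + (#A : ℤ)) := ⟨by lia, by lia⟩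
    have hdvd : (#A : ℤ) ∣ y - (l + (y - l) % #A) :=
      ⟨(y - l) / #A, by linarith [Int.mul_ediv_add_emod (y - l) #A]⟩
    rwa [(hres A hA y).unique ⟨hy, by simp⟩ ⟨hsub hmem, hdvd⟩]
  have interval : ∀ e : E, ∃ l : ℤ, ∀ A : Finset E, e ∈ A → S A = Set.Ico l (l + #A) := by
    intro e
    obtain ⟨l, ⟨hl, -⟩, -⟩ := hres {e} (singleton_nonempty e) 0
    refine ⟨l, fun A heA => ?_⟩
    suffices h : ∀ B : Finset E, e ∉ B →
        S (insert e B) = Set.Ico l (l + (#(insert e B) : ℤ)) by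
      simpa [heA] using h (A.erase e) (by simp)
    intro B
    induction B using Finset.induction_on with
    | empty =>
      intro _
      apply eq_of_subset _ _ (by simp)
      intro y hy
      have : y = l := by
        simp only [insert_empty_eq, card_singleton, Nat.cast_one, Set.mem_Ico] at hy
        lia
      simpa [this] using hl
    | insert f B hf ih =>
      intro he
      simp only [mem_insert, not_or] at he
      have hfe : f ∉ insert e B := by simp [hf, Ne.symm he.1]
      have hB := ih he.2
      rw [Finset.insert_comm]
      apply eq_of_subset _ _ (by simp)
      rintro y ⟨hy₁, hy₂⟩
      rw [card_insert_of_notMem hfe] at hy₂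
      have hcard : 0 < #(insert e B) := by simp [card_pos]
      push_cast at hy₂
      by_cases hy : y = l
      · exact (hadd _ y (by rw [hB]; exact ⟨hy₁, by lia⟩) f hfe).1
      · have := (hadd _ (y - 1) (by rw [hB]; exact ⟨by lia, by lia⟩) f hfe).2
        rwa [sub_add_cancel] at this
  choose l hl using interval
  obtain ⟨e₀⟩ := ‹Nonempty E›
  refine ⟨l e₀, fun A ⟨e, he⟩ => ?_⟩
  have hpos : 0 < #(univ : Finset E) := card_pos.2 ⟨e, mem_univ e⟩
  have huniv := (hl e univ (mem_univ e)).symm.trans (hl e₀ univ (mem_univ e₀))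
  have h₁ := (Set.ext_iff.1 huniv (l e)).1 ⟨le_rfl, by lia⟩
  have h₂ := (Set.ext_iff.1 huniv (l e₀)).2 ⟨le_rfl, by lia⟩
  rw [hl e A he, le_antisymm h₂.1 h₁.1]

section Vine

variable {ends : E → V × V} {v₁ v₂ : V}

omit [Fintype V] in
theorem pairFn_injective_left {a a' b b' : ℤ} (h : pairFn v₁ a b = pairFn v₁ a' b') : a = a' := by
  simpa [pairFn] using congrFun h v₁

theorem mem_Sdeg_iff_eq_pairFn (hne : v₁ ≠ v₂) (hV : (univ : Finset V) = {v₁, v₂}) {d : ℤ}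
    {A : Finset E} {x : V → ℤ} :
    x ∈ Sdeg d A ↔ x = pairFn v₁ (x v₁) (d - nG A - x v₁) := by
  have hv : ∀ v : V, v = v₁ ∨ v = v₂ := fun v => by
    simpa [hV] using mem_univ v
  simp only [Sdeg, Set.mem_ofPred_eq, hV, sum_pair hne]
  constructor
  · intro h
    ext v
    rcases hv v with rfl | rfl
    · simp [pairFn]
    · simp only [pairFn, hne.symm, if_false]
      lia
  · intro h
    have := congrFun h v₂
    simp only [pairFn, hne.symm, if_false] at this
    lia

omit [Fintype E] [DecidableEq E] in
theorem conn_of_nonempty (hV : (univ : Finset V) = {v₁, v₂})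
    (hE : ∀ e : E, eSym ends e = s(v₁, v₂)) {A : Finset E} (hA : A.Nonempty) : Conn ends A := by
  have hv : ∀ v : V, v = v₁ ∨ v = v₂ := fun v => by
    simpa [hV] using mem_univ v
  obtain ⟨e, he⟩ := hA
  refine ⟨⟨v₁⟩, fun v w => ?_⟩
  rcases hv v with rfl | rfl <;> rcases hv w with rfl | rfl
  · exact .refl
  · exact .single ⟨e, he, hE e⟩
  · exact .single ⟨e, he, (hE e).trans Sym2.eq_swap⟩
  · exact .refl

omit [Fintype E] [DecidableEq E] in
theorem mem_twGroup_iff (hne : v₁ ≠ v₂) (hV : (univ : Finset V) = {v₁, v₂})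
    (hE : ∀ e : E, eSym ends e = s(v₁, v₂)) {A : Finset E} {x : V → ℤ} :
    x ∈ twGroup ends A ↔ ∃ n : ℤ, x = pairFn v₁ (n * #A) (-(n * #A)) := by
  have hv : ∀ v : V, v = v₁ ∨ v = v₂ := fun v => by
    simpa [hV] using mem_univ v
  have h₁ : twVec ends A v₁ = pairFn v₁ (-#A) #A := by
    ext w
    rcases hv w with rfl | rfl
    · simp [twVec, pairFn, hE, hne]
    · simp [twVec, pairFn, hE, hne.symm]
  have h₂ : twVec ends A v₂ = -pairFn v₁ (-#A) #A := by
    ext w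
    rcases hv w with rfl | rfl
    · simp [twVec, pairFn, hE, hne, Sym2.eq_swap]
    · simp [twVec, pairFn, hE, hne, hne.symm]
  have hgroup : twGroup ends A = AddSubgroup.zmultiples (pairFn v₁ (-#A) #A) := by
    apply le_antisymm
    · rw [twGroup, AddSubgroup.closure_le]
      rintro _ ⟨v, rfl⟩
      rcases hv v with rfl | rfl
      · rw [h₁]
        exact AddSubgroup.mem_zmultiples _
      · rw [h₂]
        exact neg_mem (AddSubgroup.mem_zmultiples _)
    · rw [AddSubgroup.zmultiples_le]
      exact AddSubgroup.subset_closure ⟨v₁, h₁⟩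
  have hsmul : ∀ n : ℤ, n • pairFn v₁ (-#A) #A = pairFn v₁ (-n * #A) (-(-n * #A)) := by
    intro n
    ext w
    by_cases hw : w = v₁ <;> simp [pairFn, hw]
  rw [hgroup, AddSubgroup.mem_zmultiples_iff]
  constructor
  · rintro ⟨n, rfl⟩
    exact ⟨-n, hsmul n⟩
  · rintro ⟨n, rfl⟩
    exact ⟨-n, by rw [hsmul, neg_neg]⟩

/-- On a vine graph, a stability assignment is given by intervals with a common left end. -/
theorem IsStabilityAssignment.exists_mem_iff [Nonempty E] (hne : v₁ ≠ v₂)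
    (hV : (univ : Finset V) = {v₁, v₂}) (hE : ∀ e : E, eSym ends e = s(v₁, v₂)) {d : ℤ}
    {σ : Finset E → Set (V → ℤ)} (hσ : IsStabilityAssignment ends d σ) :
    ∃ l : ℤ, ∀ A : Finset E, A.Nonempty → ∀ x : V → ℤ,
      x ∈ σ A ↔ ∃ a ∈ Set.Ico l (l + #A), x = pairFn v₁ a (d - nG A - a) := by
  obtain ⟨hassign, hchip, hrep⟩ := hσ
  have eq_pairFn : ∀ {A x}, x ∈ σ A → x = pairFn v₁ (x v₁) (d - nG A - x v₁) :=
    fun hx => (mem_Sdeg_iff_eq_pairFn hne hV).1 (hassign _ _ hx).2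
  let S : Finset E → Set ℤ := fun A => {a | pairFn v₁ a (d - nG A - a) ∈ σ A}
  have hadd : ∀ A, ∀ a ∈ S A, ∀ e ∉ A, a ∈ S (insert e A) ∧ a + 1 ∈ S (insert e A) := by
    intro A a ha e he
    have h₁ := hchip A _ ha e he v₁ (by simp [hE])
    have h₂ := hchip A _ ha e he v₂ (by simp [hE])
    constructor
    · have := eq_pairFn h₂
      rw [this] at h₂
      simpa [S, pairFn, stdVec, hne] using h₂
    · have := eq_pairFn h₁
      rw [this] at h₁
      simpa [S, pairFn, stdVec] using h₁
  have hres : ∀ A : Finset E, A.Nonempty → ∀ a, ∃! b, b ∈ S A ∧ (#A : ℤ) ∣ a - b := by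
    intro A hA a
    have hsub : ∀ b : ℤ, pairFn v₁ a (d - nG A - a) - pairFn v₁ b (d - nG A - b) ∈ twGroup ends A ↔
        (#A : ℤ) ∣ a - b := by
      intro b
      have : pairFn v₁ a (d - nG A - a) - pairFn v₁ b (d - nG A - b) =
          pairFn v₁ (a - b) (-(a - b)) := by
        ext w
        by_cases hw : w = v₁ <;> simp [pairFn, hw]
      rw [this, mem_twGroup_iff hne hV hE, dvd_iff_exists_eq_mul_left]
      exact exists_congr fun n => ⟨pairFn_injective_left, fun h => by rw [h]⟩
    obtain ⟨y, ⟨hy, hay⟩, huniq⟩ := (hrep A (conn_of_nonempty hV hE hA)).2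
      (pairFn v₁ a (d - nG A - a)) ((mem_Sdeg_iff_eq_pairFn hne hV).2 (by simp [pairFn]))
    rw [eq_pairFn hy] at hay
    rw [eq_pairFn hy] at hy
    refine ⟨y v₁, ⟨hy, (hsub _).1 hay⟩, ?_⟩
    rintro b ⟨hb, hab⟩
    simpa [pairFn] using congrFun (huniq _ ⟨hb, (hsub b).2 hab⟩) v₁
  obtain ⟨l, hl⟩ := exists_eq_Ico_of_residues hadd hres
  refine ⟨l, fun A hA x => ?_⟩
  rw [← hl A hA]
  constructor
  · intro hx
    exact ⟨x v₁, by rw [Set.mem_ofPred_eq, ← eq_pairFn hx]; exact hx, eq_pairFn hx⟩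
  · rintro ⟨a, ha, rfl⟩
    exact ha

end Vine

/-- For a vine graph with two vertices `v₁, v₂` joined by `t ≥ 1` edges,
every degree-`d` stability assignment `σ` is determined by a unique integer `λ`:
`σ(Γᵢ) = {(λ, d+1−λ−t)}` on every spanning tree (single-edge subgraph) `Γᵢ`, and
`σ(Γ) = {(λ, d−λ), …, (λ+t−1, d+1−λ−t)}`. -/
theorem statement7 (ends : E → V × V) (d : ℤ) (v₁ v₂ : V) (hne : v₁ ≠ v₂)
    (hV : (Finset.univ : Finset V) = {v₁, v₂})
    (hE : ∀ e : E, eSym ends e = s(v₁, v₂)) (ht : 1 ≤ Fintype.card E)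
    (σ : Finset E → Set (V → ℤ)) (hσ : IsStabilityAssignment ends d σ) :
    ∃! lam : ℤ,
      (∀ e : E, σ {e} = {pairFn v₁ lam (d + 1 - lam - (Fintype.card E : ℤ))}) ∧
        σ (Finset.univ : Finset E) = {x : V → ℤ | ∃ j : ℕ, j < Fintype.card E ∧
          x = pairFn v₁ (lam + (j : ℤ)) (d - lam - (j : ℤ))} := by
  have : Nonempty E := Fintype.card_pos_iff.1 ht
  obtain ⟨l, hl⟩ := hσ.exists_mem_iff hne hV hE
  have hsingle : ∀ e : E, σ {e} = {pairFn v₁ l (d + 1 - l - (Fintype.card E : ℤ))} := by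
    intro e
    have hn : (nG ({e} : Finset E) : ℤ) = Fintype.card E - 1 := by
      have := card_sdiff_add_card_eq_card (subset_univ ({e} : Finset E))
      rw [card_singleton, card_univ] at this
      unfold nG
      lia
    have hdeg : d + 1 - l - (Fintype.card E : ℤ) = d - nG ({e} : Finset E) - l := by lia
    ext x
    rw [hl {e} (singleton_nonempty e), Set.mem_singleton_iff, hdeg]
    constructor
    · rintro ⟨a, ⟨ha₁, ha₂⟩, rfl⟩
      rw [card_singleton] at ha₂
      rw [show a = l by lia]
    · rintro rfl
      exact ⟨l, ⟨le_rfl, by simp⟩, rfl⟩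
  refine ⟨l, ⟨hsingle, ?_⟩, ?_⟩
  · ext x
    rw [hl univ univ_nonempty, card_univ]
    simp only [Set.mem_ofPred_eq, nG, sdiff_self, bot_eq_empty, card_empty, Nat.cast_zero, sub_zero,
      sub_sub]
    constructor
    · rintro ⟨a, ⟨ha₁, ha₂⟩, rfl⟩
      refine ⟨(a - l).toNat, by lia, ?_⟩
      rw [show l + ((a - l).toNat : ℤ) = a by lia]
    · rintro ⟨j, hj, rfl⟩
      exact ⟨l + j, ⟨by lia, by lia⟩, rfl⟩
  · rintro m ⟨hm, -⟩
    obtain ⟨e⟩ := this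
    exact pairFn_injective_left (Set.singleton_injective ((hm e).symm.trans (hsingle e)))
end

section
/- Let Γ be the multigraph with two vertices v₁, v₂ joined by t ≥ 1 edges and no other edges, let λ ∈ ℤ, and let σ be a degree-d stability assignment for Γ such that σ(T) = {(λ, d+1−λ−t)} for every spanning tree T of Γ. Define φ ∈ V^d(Γ) by φ(v₁) := λ + (t−1)/2 and φ(v₂) := d − λ − (t−1)/2. Then φ is nondegenerate and σ = stab_{Γ,φ}; in particular, for every spanning subgraph G of Γ with k ≥ 1 edges, σ(G) = stab_{Γ,φ}(G) = {(λ+j, d−(t−k)−λ−j) : j = 0, …, k−1}. -/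
open Finset

variable {V E : Type} [Fintype V] [Fintype E] [DecidableEq V] [DecidableEq E]

/-- The numerical polarization `φ(v₁) = λ + (t−1)/2`, `φ(v₂) = d − λ − (t−1)/2` on a
two-vertex vine graph. -/
noncomputable def vinePhi (v₁ : V) (d lam : ℤ) (t : ℕ) : V → ℝ := fun w =>
  if w = v₁ then (lam : ℝ) + ((t : ℝ) - 1) / 2 else (d : ℝ) - (lam : ℝ) - ((t : ℝ) - 1) / 2

section VineGraph

set_option linter.unusedSectionVars false

variable {ends : E → V × V} {d lam : ℤ} {v₁ v₂ : V} {A : Finset E} {x : V → ℤ}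

/-- The multidegrees `(λ + j, d - (t - k) - λ - j)`, `0 ≤ j < k`, on a spanning subgraph with
`k` of the `t` edges of a vine graph. -/
def vineDegrees (v₁ : V) (d lam : ℤ) (A : Finset E) : Set (V → ℤ) :=
  {x : V → ℤ | ∃ j : ℕ, j < A.card ∧
    x = pairFn v₁ (lam + (j : ℤ)) (d - ((Fintype.card E : ℤ) - (A.card : ℤ)) - lam - (j : ℤ))}

lemma vine_endpoints (hE : ∀ e : E, eSym ends e = s(v₁, v₂)) (e : E) :
    ((ends e).1 = v₁ ∧ (ends e).2 = v₂) ∨ ((ends e).1 = v₂ ∧ (ends e).2 = v₁) := by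
  simpa [eSym, Prod.ext_iff] using hE e

lemma eq_or_eq_of_univ_eq_pair (hV : (Finset.univ : Finset V) = {v₁, v₂}) (v : V) :
    v = v₁ ∨ v = v₂ := by
  have h := Finset.mem_univ v
  rw [hV] at h
  simpa using h

lemma vine_conn (hV : (Finset.univ : Finset V) = {v₁, v₂})
    (hE : ∀ e : E, eSym ends e = s(v₁, v₂)) (hA : A.Nonempty) : Conn ends A := by
  obtain ⟨e, he⟩ := hA
  refine ⟨⟨v₁⟩, fun v w => ?_⟩
  rcases eq_or_eq_of_univ_eq_pair hV v with rfl | rfl <;>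
    rcases eq_or_eq_of_univ_eq_pair hV w with rfl | rfl
  · exact .refl
  · exact .single ⟨e, he, hE e⟩
  · exact .single ⟨e, he, (hE e).trans Sym2.eq_swap⟩
  · exact .refl

lemma vine_not_conn_empty (hne : v₁ ≠ v₂) : ¬ Conn ends (∅ : Finset E) := by
  rintro ⟨-, h⟩
  rcases Relation.ReflTransGen.cases_head (h v₁ v₂) with h | ⟨_, ⟨e, he, -⟩, -⟩
  · exact hne h
  · simp at he

lemma vine_isSpanningTree (hne : v₁ ≠ v₂) (hV : (Finset.univ : Finset V) = {v₁, v₂})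
    (hE : ∀ e : E, eSym ends e = s(v₁, v₂)) (e : E) : IsSpanningTree ends {e} := by
  refine ⟨vine_conn hV hE ⟨e, by simp⟩, ?_⟩
  rw [← Finset.card_univ, hV, Finset.card_pair hne, Finset.card_singleton]

lemma sum_univ_pair {M : Type*} [AddCommMonoid M] (hne : v₁ ≠ v₂)
    (hV : (Finset.univ : Finset V) = {v₁, v₂}) (f : V → M) : ∑ v, f v = f v₁ + f v₂ := by
  rw [hV, Finset.sum_pair hne]

lemma nG_cast (A : Finset E) : (nG A : ℤ) = Fintype.card E - A.card := by
  have h := Finset.card_sdiff_add_card_eq_card (Finset.subset_univ A)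
  rw [Finset.card_univ] at h
  unfold nG
  omega

lemma mem_Sdeg_vine (hne : v₁ ≠ v₂) (hV : (Finset.univ : Finset V) = {v₁, v₂}) :
    x ∈ Sdeg d A ↔ x v₁ + x v₂ = d - ((Fintype.card E : ℤ) - A.card) := by
  simp only [Sdeg, Set.mem_ofPred_eq, sum_univ_pair hne hV, nG_cast]

lemma mem_vineDegrees_iff (hne : v₁ ≠ v₂) (hV : (Finset.univ : Finset V) = {v₁, v₂}) :
    x ∈ vineDegrees v₁ d lam A ↔
      x ∈ Sdeg d A ∧ lam ≤ x v₁ ∧ x v₁ < lam + A.card := by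
  rw [mem_Sdeg_vine hne hV]
  constructor
  · rintro ⟨j, hj, rfl⟩
    simp only [pairFn, if_true, if_neg hne.symm]
    omega
  · rintro ⟨hs, h1, h2⟩
    refine ⟨(x v₁ - lam).toNat, by omega, funext fun v => ?_⟩
    rcases eq_or_eq_of_univ_eq_pair hV v with rfl | rfl
    · simp only [pairFn, if_true]
      omega
    · simp only [pairFn, if_neg hne.symm]
      omega

lemma eq_singleton_of_proper (hV : (Finset.univ : Finset V) = {v₁, v₂})
    {W : Finset V} (hW : W.Nonempty) (hW' : W ≠ Finset.univ) : W = {v₁} ∨ W = {v₂} := by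
  have hs : (W : Set V) ⊆ {v₁, v₂} := fun v _ => eq_or_eq_of_univ_eq_pair hV v
  rcases Set.subset_pair_iff_eq.mp hs with h | h | h | h
  · exact absurd (Finset.coe_eq_empty.mp h) hW.ne_empty
  · exact .inl (Finset.coe_eq_singleton.mp h)
  · exact .inr (Finset.coe_eq_singleton.mp h)
  · refine absurd ?_ hW'
    rw [hV]
    exact_mod_cast h

lemma vine_inE (hne : v₁ ≠ v₂) (hE : ∀ e : E, eSym ends e = s(v₁, v₂)) (v : V) :
    inE ends {v} = ∅ := by
  refine Finset.filter_eq_empty_iff.mpr fun e _ => ?_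
  simp only [Finset.mem_singleton]
  grind [vine_endpoints hE e]

lemma vine_cutE (hne : v₁ ≠ v₂) (hE : ∀ e : E, eSym ends e = s(v₁, v₂)) {v : V}
    (hv : v = v₁ ∨ v = v₂) : cutE ends {v} = Finset.univ := by
  refine Finset.filter_true_of_mem fun e _ => ?_
  simp only [Finset.mem_singleton]
  grind [vine_endpoints hE e]

/-- All the quantities in the stability inequalities of a vine graph agree. -/
lemma vine_stability_terms (hne : v₁ ≠ v₂) (hV : (Finset.univ : Finset V) = {v₁, v₂})
    (hE : ∀ e : E, eSym ends e = s(v₁, v₂)) (hx : x ∈ Sdeg d A)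
    {W : Finset V} (hW : W.Nonempty) (hW' : W ≠ Finset.univ) :
    |(∑ v ∈ W, ((x v : ℝ) - vinePhi v₁ d lam (Fintype.card E) v)) +
        (((Finset.univ \ A) ∩ inE ends W).card : ℝ) +
        (((Finset.univ \ A) ∩ cutE ends W).card : ℝ) / 2| =
      |(x v₁ : ℝ) - lam - ((A.card : ℝ) - 1) / 2| ∧
    ((A ∩ cutE ends W).card : ℝ) / 2 = (A.card : ℝ) / 2 := by
  have hn : ((Finset.univ \ A).card : ℝ) = Fintype.card E - A.card := by
    exact_mod_cast nG_cast A
  have hs : (x v₁ : ℝ) + x v₂ = d - ((Fintype.card E : ℝ) - A.card) := by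
    exact_mod_cast (mem_Sdeg_vine hne hV).mp hx
  rcases eq_singleton_of_proper hV hW hW' with rfl | rfl
  · rw [vine_inE hne hE, vine_cutE hne hE (.inl rfl)]
    simp only [Finset.inter_univ, Finset.inter_empty, Finset.sum_singleton, hn, vinePhi, if_true,
      Finset.card_empty, Nat.cast_zero, and_true]
    congr 1
    ring
  · rw [vine_inE hne hE, vine_cutE hne hE (.inr rfl)]
    simp only [Finset.inter_univ, Finset.inter_empty, Finset.sum_singleton, hn, vinePhi,
      if_neg hne.symm, Finset.card_empty, Nat.cast_zero, and_true]
    rw [← abs_neg]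
    congr 1
    linarith

lemma vine_phiSemistable_iff (hne : v₁ ≠ v₂) (hV : (Finset.univ : Finset V) = {v₁, v₂})
    (hE : ∀ e : E, eSym ends e = s(v₁, v₂)) (hx : x ∈ Sdeg d A) :
    PhiSemistable ends (vinePhi v₁ d lam (Fintype.card E)) A x ↔
      lam ≤ x v₁ ∧ x v₁ < lam + A.card := by
  constructor
  · intro h
    have h2 : ({v₁} : Finset V) ≠ Finset.univ := fun h =>
      hne (Finset.mem_singleton.mp (h ▸ Finset.mem_univ v₂)).symm
    have h3 := h {v₁} (Finset.singleton_nonempty v₁) h2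
    obtain ⟨e1, e2⟩ := vine_stability_terms (lam := lam) hne hV hE hx
      (Finset.singleton_nonempty v₁) h2
    rw [e1, e2, abs_le] at h3
    have h4 : (lam : ℝ) < ((x v₁ + 1 : ℤ) : ℝ) := by push_cast; linarith
    have h5 : (x v₁ : ℝ) < ((lam + A.card : ℤ) : ℝ) := by push_cast; linarith
    exact ⟨Int.lt_add_one_iff.mp (Int.cast_lt.mp h4), Int.cast_lt.mp h5⟩
  · rintro ⟨h1, h2⟩ W hW hW'
    obtain ⟨e1, e2⟩ := vine_stability_terms (lam := lam) hne hV hE hx hW hW'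
    have h1' : (lam : ℝ) ≤ x v₁ := by exact_mod_cast h1
    have h2' : (x v₁ : ℝ) + 1 ≤ lam + A.card := by exact_mod_cast h2
    rw [e1, e2, abs_le]
    constructor <;> linarith

lemma vine_nondegenerate (hne : v₁ ≠ v₂) (hV : (Finset.univ : Finset V) = {v₁, v₂})
    (hE : ∀ e : E, eSym ends e = s(v₁, v₂)) :
    Nondegenerate ends d (vinePhi v₁ d lam (Fintype.card E)) := by
  intro A x hx h W hW hW'
  obtain ⟨h1, h2⟩ := (vine_phiSemistable_iff hne hV hE hx).mp h
  obtain ⟨e1, e2⟩ := vine_stability_terms (lam := lam) hne hV hE hx hW hW'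
  have h1' : (lam : ℝ) ≤ x v₁ := by exact_mod_cast h1
  have h2' : (x v₁ : ℝ) + 1 ≤ lam + A.card := by exact_mod_cast h2
  rw [e1, e2, abs_lt]
  constructor <;> linarith

lemma vine_semistable_set (hne : v₁ ≠ v₂) (hV : (Finset.univ : Finset V) = {v₁, v₂})
    (hE : ∀ e : E, eSym ends e = s(v₁, v₂)) (A : Finset E) :
    {x : V → ℤ | x ∈ Sdeg d A ∧
      PhiSemistable ends (vinePhi v₁ d lam (Fintype.card E)) A x} = vineDegrees v₁ d lam A := by
  ext x
  rw [mem_vineDegrees_iff hne hV]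
  exact and_congr_right fun hx => vine_phiSemistable_iff hne hV hE hx

lemma vineDegrees_subset {σ : Finset E → Set (V → ℤ)} (hne : v₁ ≠ v₂)
    (hV : (Finset.univ : Finset V) = {v₁, v₂})
    (hE : ∀ e : E, eSym ends e = s(v₁, v₂)) (hσ : ChipAdding ends σ)
    (hσT : ∀ T : Finset E, IsSpanningTree ends T →
      σ T = {pairFn v₁ lam (d + 1 - lam - (Fintype.card E : ℤ))})
    (hA : A.Nonempty) : vineDegrees v₁ d lam A ⊆ σ A := by
  induction hA using Finset.Nonempty.cons_induction with
  | singleton e =>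
    rintro x ⟨j, hj, rfl⟩
    rw [hσT _ (vine_isSpanningTree hne hV hE e), Set.mem_singleton_iff]
    obtain rfl : j = 0 := by simpa using hj
    congr 1
    · simp
    · simp only [Finset.card_singleton, Nat.cast_one, Nat.cast_zero]
      ring
  | cons e A he hA ih =>
    intro x hx
    rw [Finset.cons_eq_insert] at hx ⊢
    obtain ⟨hs, h1, h2⟩ := (mem_vineDegrees_iff hne hV).mp hx
    rw [mem_Sdeg_vine hne hV] at hs
    rw [Finset.card_insert_of_notMem he] at hs h2
    push_cast at hs h2
    have hpos : (0 : ℤ) < A.card := by exact_mod_cast hA.card_pos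
    have key : ∃ v ∈ eSym ends e, x - stdVec v ∈ vineDegrees v₁ d lam A := by
      rw [hE e]
      rcases h1.eq_or_lt with h | h
      · refine ⟨v₂, by simp, (mem_vineDegrees_iff hne hV).mpr ?_⟩
        rw [mem_Sdeg_vine hne hV]
        simp only [Pi.sub_apply, stdVec, if_true, if_neg hne]
        omega
      · refine ⟨v₁, by simp, (mem_vineDegrees_iff hne hV).mpr ?_⟩
        rw [mem_Sdeg_vine hne hV]
        simp only [Pi.sub_apply, stdVec, if_true, if_neg hne.symm]
        omega
    obtain ⟨v, hv, hxv⟩ := key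
    simpa using hσ A _ (ih hxv) e he v hv

lemma vine_smul_twVec (hne : v₁ ≠ v₂) (hV : (Finset.univ : Finset V) = {v₁, v₂})
    (hE : ∀ e : E, eSym ends e = s(v₁, v₂)) (q : ℤ) (A : Finset E) :
    q • twVec ends A v₂ = pairFn v₁ (A.card * q) (-(A.card * q)) := by
  funext v
  rcases eq_or_eq_of_univ_eq_pair hV v with rfl | rfl
  · have h : A.filter (fun e => eSym ends e = s(v₂, v)) = A :=
      Finset.filter_true_of_mem fun e _ => (hE e).trans Sym2.eq_swap
    simp only [Pi.smul_apply, twVec, if_neg hne, h, pairFn, if_true, smul_eq_mul]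
    ring
  · have h : A.filter (fun e => v ∈ eSym ends e ∧ ¬(eSym ends e).IsDiag) = A :=
      Finset.filter_true_of_mem fun e _ => by simp [hE e, hne]
    simp only [Pi.smul_apply, twVec, if_true, h, pairFn, if_neg hne.symm, smul_eq_mul]
    ring

/-- Every multidegree of a connected spanning subgraph of a vine graph is equivalent to one
in `vineDegrees`. -/
lemma exists_mem_vineDegrees (hne : v₁ ≠ v₂) (hV : (Finset.univ : Finset V) = {v₁, v₂})
    (hE : ∀ e : E, eSym ends e = s(v₁, v₂)) (hA : A.Nonempty) (hx : x ∈ Sdeg d A) :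
    ∃ y ∈ vineDegrees v₁ d lam A, x - y ∈ twGroup ends A := by
  have hpos : (0 : ℤ) < A.card := by exact_mod_cast hA.card_pos
  set q := (x v₁ - lam) / A.card with hq
  have hdiv := Int.mul_ediv_add_emod (x v₁ - lam) A.card
  have h0 := Int.emod_nonneg (x v₁ - lam) hpos.ne'
  have h1 := Int.emod_lt_of_pos (x v₁ - lam) hpos
  rw [← hq] at hdiv
  refine ⟨x - q • twVec ends A v₂, ?_, ?_⟩
  · rw [mem_Sdeg_vine hne hV] at hx
    rw [mem_vineDegrees_iff hne hV, mem_Sdeg_vine hne hV, vine_smul_twVec hne hV hE]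
    simp only [Pi.sub_apply, pairFn, if_true, if_neg hne.symm]
    refine ⟨by linarith, by linarith, by linarith⟩
  · rw [sub_sub_cancel]
    exact zsmul_mem (AddSubgroup.subset_closure (Set.mem_range_self v₂)) q

lemma IsRepSet.eq_vineDegrees {S : Set (V → ℤ)} (hne : v₁ ≠ v₂)
    (hV : (Finset.univ : Finset V) = {v₁, v₂})
    (hE : ∀ e : E, eSym ends e = s(v₁, v₂)) (hA : A.Nonempty) (hS : IsRepSet ends d A S)
    (hsub : vineDegrees v₁ d lam A ⊆ S) : S = vineDegrees v₁ d lam A := by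
  refine Set.Subset.antisymm (fun x hx => ?_) hsub
  obtain ⟨y, hy, hxy⟩ := exists_mem_vineDegrees (lam := lam) hne hV hE hA (hS.1 hx)
  have hxx : x - x ∈ twGroup ends A := by
    rw [sub_self]
    exact zero_mem _
  rwa [(hS.2 x (hS.1 hx)).unique ⟨hx, hxx⟩ ⟨hsub hy, hxy⟩]

end VineGraph

/-- On a vine graph of type `t ≥ 1`, a degree-`d` stability assignment
with `σ(T) = {(λ, d+1−λ−t)}` on all spanning trees coincides with the numerical stability
`stab_{Γ,φ}` for the nondegenerate polarization `φ = (λ + (t−1)/2, d − λ − (t−1)/2)`;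
in particular on every spanning subgraph `G` with `k ≥ 1` edges,
`σ(G) = stab_{Γ,φ}(G) = {(λ+j, d−(t−k)−λ−j) : 0 ≤ j ≤ k−1}`. -/
theorem statement8 (ends : E → V × V) (d : ℤ) (v₁ v₂ : V) (hne : v₁ ≠ v₂)
    (hV : (Finset.univ : Finset V) = {v₁, v₂})
    (hE : ∀ e : E, eSym ends e = s(v₁, v₂)) (ht : 1 ≤ Fintype.card E)
    (lam : ℤ) (σ : Finset E → Set (V → ℤ)) (hσ : IsStabilityAssignment ends d σ)
    (hσT : ∀ T : Finset E, IsSpanningTree ends T →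
      σ T = {pairFn v₁ lam (d + 1 - lam - (Fintype.card E : ℤ))}) :
    (∑ v : V, vinePhi v₁ d lam (Fintype.card E) v = (d : ℝ)) ∧
      Nondegenerate ends d (vinePhi v₁ d lam (Fintype.card E)) ∧
      σ = stabAssign ends d (vinePhi v₁ d lam (Fintype.card E)) ∧
      ∀ A : Finset E, A.Nonempty →
        σ A = {x : V → ℤ | ∃ j : ℕ, j < A.card ∧
            x = pairFn v₁ (lam + (j : ℤ))
              (d - ((Fintype.card E : ℤ) - (A.card : ℤ)) - lam - (j : ℤ))} ∧
        {x : V → ℤ | x ∈ Sdeg d A ∧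
            PhiSemistable ends (vinePhi v₁ d lam (Fintype.card E)) A x} =
          {x : V → ℤ | ∃ j : ℕ, j < A.card ∧
            x = pairFn v₁ (lam + (j : ℤ))
              (d - ((Fintype.card E : ℤ) - (A.card : ℤ)) - lam - (j : ℤ))} := by
  have hσA : ∀ A : Finset E, A.Nonempty → σ A = vineDegrees v₁ d lam A := fun A hA =>
    (hσ.2.2 A (vine_conn hV hE hA)).eq_vineDegrees hne hV hE hA
      (vineDegrees_subset hne hV hE hσ.2.1 hσT hA)
  refine ⟨?_, vine_nondegenerate hne hV hE, ?_,
    fun A hA => ⟨hσA A hA, vine_semistable_set hne hV hE A⟩⟩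
  · rw [sum_univ_pair hne hV]
    simp only [vinePhi, if_true, if_neg hne.symm]
    ring
  · funext A
    rcases A.eq_empty_or_nonempty with rfl | hA
    · ext x
      exact iff_of_false (fun hx => vine_not_conn_empty hne (hσ.1 ∅ x hx).1)
        fun hx => vine_not_conn_empty hne hx.1
    · rw [hσA A hA, ← vine_semistable_set hne hV hE A]
      ext x
      exact (and_iff_right (vine_conn hV hE hA)).symm
end

section
/- Let Γ be a finite connected multigraph and let φ ∈ V^d(Γ) be nondegenerate. Then the numerical assignment stab_{Γ,φ} = { (G,𝐝) : G a connected spanning subgraph of Γ, 𝐝 ∈ S^d_Γ(G) φ-semistable on G } is a degree-d stability assignment for Γ, i.e. it satisfies conditions (1) and (2). -/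
open Finset

variable {V E : Type} [Fintype V] [Fintype E] [DecidableEq V] [DecidableEq E]

set_option linter.unusedSectionVars false

/-- The difference of the values of `c` at the two endpoints of the edge `e`. -/
def edgeDiff (ends : E → V × V) (c : V → ℤ) (e : E) : ℤ :=
  c (ends e).1 - c (ends e).2

/-- The integral indicator function of a vertex set. -/
def indVec (W : Finset V) : V → ℤ := fun v => if v ∈ W then 1 else 0

/-- The combination of twisters with coefficients `c`; this is minus the Laplacian of `c`. -/
def twComb (ends : E → V × V) (A : Finset E) (c : V → ℤ) : V → ℤ :=
  fun w => ∑ v, c v * twVec ends A v w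

/-- The deviation of `x` from the polarization, corrected by half the valence in the
complement of `A`. -/
noncomputable def deviation (ends : E → V × V) (φ : V → ℝ) (A : Finset E) (x : V → ℤ)
    (v : V) : ℝ :=
  (x v : ℝ) - φ v + ∑ e ∈ univ \ A,
    ((if (ends e).1 = v then (1 : ℝ) else 0) + (if (ends e).2 = v then 1 else 0)) / 2

lemma twVec_eq_sum (ends : E → V × V) (A : Finset E) (v w : V) :
    twVec ends A v w =
      -∑ e ∈ A, edgeDiff ends (Pi.single v (1 : ℤ)) e * edgeDiff ends (Pi.single w 1) e := by
  unfold twVec edgeDiff eSym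
  rw [← Finset.sum_neg_distrib]
  split_ifs with h
  · subst h
    rw [Finset.card_filter, Nat.cast_sum, ← Finset.sum_neg_distrib]
    refine Finset.sum_congr rfl fun e _ => ?_
    simp only [Sym2.mem_iff, Sym2.mk_isDiag_iff, Pi.single_apply]
    grind
  · rw [Finset.card_filter, Nat.cast_sum]
    refine Finset.sum_congr rfl fun e _ => ?_
    simp only [Sym2.eq_iff, Pi.single_apply]
    grind

lemma sum_mul_edgeDiff_single (ends : E → V × V) (c : V → ℤ) (e : E) :
    ∑ v, c v * edgeDiff ends (Pi.single v (1 : ℤ)) e = edgeDiff ends c e := by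
  simp [edgeDiff, mul_sub, Finset.sum_sub_distrib, Pi.single_apply]

lemma sum_mul_twComb (ends : E → V × V) (A : Finset E) (b c : V → ℤ) :
    ∑ w, b w * twComb ends A c w = -∑ e ∈ A, edgeDiff ends b e * edgeDiff ends c e := by
  have h : ∀ w, b w * twComb ends A c w =
      -∑ e ∈ A, (b w * edgeDiff ends (Pi.single w (1 : ℤ)) e) * edgeDiff ends c e := by
    intro w
    simp only [twComb, twVec_eq_sum, mul_neg, Finset.sum_neg_distrib, Finset.mul_sum]
    rw [Finset.sum_comm]
    congr 1
    refine Finset.sum_congr rfl fun e _ => ?_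
    rw [← sum_mul_edgeDiff_single ends c e, Finset.mul_sum]
    exact Finset.sum_congr rfl fun v _ => by ring
  simp only [h, Finset.sum_neg_distrib]
  rw [Finset.sum_comm]
  simp only [← Finset.sum_mul, sum_mul_edgeDiff_single]

lemma sum_twComb (ends : E → V × V) (A : Finset E) (c : V → ℤ) :
    ∑ w, twComb ends A c w = 0 := by
  simpa [edgeDiff] using sum_mul_twComb ends A (fun _ => 1) c

lemma sum_indVec_mul (W : Finset V) (f : V → ℤ) : ∑ w, indVec W w * f w = ∑ w ∈ W, f w := by
  simp [indVec]

lemma twComb_eq_zero_of_const (ends : E → V × V) (A : Finset E) {c : V → ℤ}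
    (hc : ∀ v w, c v = c w) : twComb ends A c = 0 := by
  funext w
  have h := sum_mul_twComb ends A (indVec {w}) c
  rw [sum_indVec_mul] at h
  simpa [edgeDiff, fun e => hc (ends e).1 (ends e).2] using h

lemma mem_twGroup_iff_s9 (ends : E → V × V) (A : Finset E) (z : V → ℤ) :
    z ∈ twGroup ends A ↔ ∃ c : V → ℤ, z = twComb ends A c := by
  have hsum : ∀ c, twComb ends A c = ∑ v, c v • twVec ends A v := by
    intro c
    funext w
    simp [twComb]
  constructor
  · intro hz
    induction hz using AddSubgroup.closure_induction with
    | mem z hz =>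
      obtain ⟨v, rfl⟩ := hz
      refine ⟨Pi.single v 1, ?_⟩
      funext w
      simp [twComb, Pi.single_apply]
    | zero => exact ⟨0, by funext w; simp [twComb]⟩
    | add x y _ _ hx hy =>
      obtain ⟨c, rfl⟩ := hx
      obtain ⟨c', rfl⟩ := hy
      exact ⟨c + c', by funext w; simp [twComb, add_mul, Finset.sum_add_distrib]⟩
    | neg x _ hx =>
      obtain ⟨c, rfl⟩ := hx
      exact ⟨-c, by funext w; simp [twComb]⟩
  · rintro ⟨c, rfl⟩
    rw [hsum]
    exact sum_mem fun v _ =>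
      zsmul_mem (AddSubgroup.subset_closure (Set.mem_range_self v) : _ ∈ twGroup ends A) _

lemma sum_edgeDiff_indVec_sq (ends : E → V × V) (A : Finset E) (W : Finset V) :
    ∑ e ∈ A, edgeDiff ends (indVec W) e ^ 2 = ((A ∩ cutE ends W).card : ℤ) := by
  have h : A ∩ cutE ends W = A.filter fun e =>
      ((ends e).1 ∈ W ∧ (ends e).2 ∉ W) ∨ ((ends e).1 ∉ W ∧ (ends e).2 ∈ W) := by
    ext e; simp [cutE]
  rw [h, Finset.card_filter, Nat.cast_sum]
  refine Finset.sum_congr rfl fun e _ => ?_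
  simp only [edgeDiff, indVec]
  grind

lemma sum_deviation (ends : E → V × V) (φ : V → ℝ) (A : Finset E) (x : V → ℤ) (W : Finset V) :
    ∑ v ∈ W, deviation ends φ A x v =
      (∑ v ∈ W, ((x v : ℝ) - φ v)) + (((Finset.univ \ A) ∩ inE ends W).card : ℝ) +
        (((Finset.univ \ A) ∩ cutE ends W).card : ℝ) / 2 := by
  have h₁ : (univ \ A) ∩ cutE ends W = (univ \ A).filter fun e =>
      ((ends e).1 ∈ W ∧ (ends e).2 ∉ W) ∨ ((ends e).1 ∉ W ∧ (ends e).2 ∈ W) := by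
    ext e; simp [cutE]
  have h₂ : (univ \ A) ∩ inE ends W = (univ \ A).filter fun e =>
      (ends e).1 ∈ W ∧ (ends e).2 ∈ W := by
    ext e; simp [inE]
  simp only [deviation, Finset.sum_add_distrib (s := W)]
  rw [add_assoc]
  congr 1
  rw [Finset.sum_comm, h₁, h₂, Finset.card_filter, Finset.card_filter, Nat.cast_sum,
    Nat.cast_sum, Finset.sum_div, ← Finset.sum_add_distrib]
  refine Finset.sum_congr rfl fun e _ => ?_
  rw [← Finset.sum_div, Finset.sum_add_distrib, Finset.sum_ite_eq, Finset.sum_ite_eq]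
  by_cases h : (ends e).1 ∈ W <;> by_cases h' : (ends e).2 ∈ W <;> simp [h, h']

lemma phiSemistable_iff (ends : E → V × V) (φ : V → ℝ) (A : Finset E) (x : V → ℤ) :
    PhiSemistable ends φ A x ↔ ∀ W : Finset V, W.Nonempty → W ≠ Finset.univ →
      |∑ v ∈ W, deviation ends φ A x v| ≤ ((A ∩ cutE ends W).card : ℝ) / 2 := by
  simp only [PhiSemistable, sum_deviation]

lemma phiStable_iff (ends : E → V × V) (φ : V → ℝ) (A : Finset E) (x : V → ℤ) :
    PhiStable ends φ A x ↔ ∀ W : Finset V, W.Nonempty → W ≠ Finset.univ →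
      |∑ v ∈ W, deviation ends φ A x v| < ((A ∩ cutE ends W).card : ℝ) / 2 := by
  simp only [PhiStable, sum_deviation]

lemma sum_univ_deviation {ends : E → V × V} {d : ℤ} {φ : V → ℝ} (hφ : ∑ v : V, φ v = (d : ℝ))
    {A : Finset E} {x : V → ℤ} (hx : x ∈ Sdeg d A) : ∑ v, deviation ends φ A x v = 0 := by
  have hx' : ∑ v, (x v : ℝ) = d - (nG A : ℝ) := by exact_mod_cast congrArg (Int.cast (R := ℝ)) hx
  rw [sum_deviation, Finset.sum_sub_distrib, hφ, hx']
  simp [inE, cutE, nG]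

lemma Conn.insert_edge {ends : E → V × V} {A : Finset E} (h : Conn ends A) (e : E) :
    Conn ends (insert e A) :=
  ⟨h.1, fun v w => Relation.ReflTransGen.mono (fun _ _ ⟨e', he', h'⟩ =>
    ⟨e', Finset.mem_insert_of_mem he', h'⟩) v w (h.2 v w)⟩

lemma add_stdVec_mem_Sdeg {d : ℤ} {A : Finset E} {x : V → ℤ} (hx : x ∈ Sdeg d A) {e : E}
    (he : e ∉ A) (v : V) : x + stdVec v ∈ Sdeg d (insert e A) := by
  have hcard : nG A = nG (insert e A) + 1 := by
    unfold nG
    rw [Finset.sdiff_insert, Finset.card_erase_add_one (by simpa using he)]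
  simp only [Sdeg, Set.mem_ofPred_eq] at hx ⊢
  simp only [Pi.add_apply, stdVec, Finset.sum_add_distrib, hx, hcard]
  simp
  ring

lemma PhiSemistable.insert_edge {ends : E → V × V} {φ : V → ℝ} {A : Finset E} {x : V → ℤ}
    (hx : PhiSemistable ends φ A x) {e : E} (he : e ∉ A) {v : V} (hv : v ∈ eSym ends e) :
    PhiSemistable ends φ (insert e A) (x + stdVec v) := by
  rw [phiSemistable_iff] at hx ⊢
  intro W hW hW'
  have h := hx W hW hW'
  have hdev : ∀ w, deviation ends φ A x w = deviation ends φ (insert e A) (x + stdVec v) w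
      - stdVec v w + ((if (ends e).1 = w then (1 : ℝ) else 0) +
        (if (ends e).2 = w then 1 else 0)) / 2 := by
    intro w
    simp only [deviation, Finset.sdiff_insert, Pi.add_apply, Int.cast_add]
    rw [← Finset.sum_erase_add (univ \ A) _ (by simpa using he : e ∈ univ \ A)]
    ring
  have hcut : ((insert e A ∩ cutE ends W).card : ℝ) =
      (A ∩ cutE ends W).card + if e ∈ cutE ends W then 1 else 0 := by
    split_ifs with hc
    · rw [Finset.insert_inter_of_mem hc, Finset.card_insert_of_notMem (by simp [he])]
      simp
    · rw [Finset.insert_inter_of_notMem hc]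
      simp
  have hstd : ∑ w ∈ W, ((stdVec v w : ℤ) : ℝ) = if v ∈ W then 1 else 0 := by
    simp [stdVec]
  simp only [hdev, Finset.sum_add_distrib, Finset.sum_sub_distrib, ← Finset.sum_div, hstd,
    Finset.sum_ite_eq] at h
  have hmem : e ∈ cutE ends W ↔
      ((ends e).1 ∈ W ∧ (ends e).2 ∉ W) ∨ ((ends e).1 ∉ W ∧ (ends e).2 ∈ W) := by
    simp [cutE]
  rw [hcut]
  simp only [hmem]
  rw [abs_le] at h ⊢
  have hv' : v = (ends e).1 ∨ v = (ends e).2 := by simpa [eSym] using hv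
  rcases hv' with rfl | rfl <;> by_cases h₁ : (ends e).1 ∈ W <;> by_cases h₂ : (ends e).2 ∈ W <;>
    simp only [h₁, h₂, if_true, if_false, not_true, not_false_eq_true, and_true, and_false,
      or_true, or_false, or_self] at h ⊢ <;>
    constructor <;> linarith [h.1, h.2]

lemma deviation_add (ends : E → V × V) (φ : V → ℝ) (A : Finset E) (x z : V → ℤ) (v : V) :
    deviation ends φ A (x + z) v = deviation ends φ A x v + z v := by
  simp only [deviation, Pi.add_apply, Int.cast_add]
  ring

/-- Two stable multidegrees that differ by a twister are equal: sum their difference over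
the set where the chip-firing script is maximal. -/
lemma PhiStable.eq_of_sub_mem_twGroup {ends : E → V × V} {φ : V → ℝ} {A : Finset E}
    {x y : V → ℤ} (hx : PhiStable ends φ A x) (hy : PhiStable ends φ A y)
    (hxy : x - y ∈ twGroup ends A) : x = y := by
  obtain ⟨c, hc⟩ := (mem_twGroup_iff_s9 ends A _).1 hxy
  by_cases hconst : ∀ v w, c v = c w
  · rw [twComb_eq_zero_of_const ends A hconst] at hc
    exact sub_eq_zero.1 hc
  exfalso
  push Not at hconst
  obtain ⟨a, b, hab⟩ := hconst
  obtain ⟨m, -, hm⟩ := Finset.exists_max_image (univ : Finset V) c ⟨a, mem_univ a⟩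
  set W : Finset V := univ.filter fun v => c v = c m with hWdef
  have hWmem : ∀ v, v ∈ W ↔ c v = c m := by simp [hWdef]
  have hW : W.Nonempty := ⟨m, by simp [hWmem]⟩
  have hW' : W ≠ univ := by
    intro h
    have ha := (hWmem a).1 (h ▸ mem_univ a)
    have hb := (hWmem b).1 (h ▸ mem_univ b)
    exact hab (ha.trans hb.symm)
  rw [phiStable_iff] at hx hy
  have h₁ := abs_lt.1 (hx W hW hW')
  have h₂ := abs_lt.1 (hy W hW hW')
  have hx_eq : x = y + twComb ends A c := by rw [← hc]; abel
  rw [hx_eq] at h₁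
  simp only [deviation_add, Finset.sum_add_distrib] at h₁
  have hle : ∑ e ∈ A, edgeDiff ends (indVec W) e ^ 2 ≤
      ∑ e ∈ A, edgeDiff ends (indVec W) e * edgeDiff ends c e := by
    refine Finset.sum_le_sum fun e _ => ?_
    have hc₁ := hm (ends e).1 (mem_univ _)
    have hc₂ := hm (ends e).2 (mem_univ _)
    simp only [edgeDiff, indVec, hWmem]
    split_ifs <;> simp <;> omega
  have hpair := sum_mul_twComb ends A (indVec W) c
  rw [sum_indVec_mul] at hpair
  rw [sum_edgeDiff_indVec_sq] at hle
  have hfin : ∑ w ∈ W, twComb ends A c w ≤ -((A ∩ cutE ends W).card : ℤ) := by omega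
  have hfin' : ∑ w ∈ W, ((twComb ends A c w : ℤ) : ℝ) ≤ -((A ∩ cutE ends W).card : ℝ) := by
    exact_mod_cast hfin
  linarith [h₁.1, h₂.2]

lemma Linked.exists_sq_le {ends : E → V × V} {A : Finset E} {v w : V} (h : Linked ends A v w) :
    ∃ N : ℕ, ∀ c : V → ℤ, (c v - c w) ^ 2 ≤ N * ∑ e ∈ A, edgeDiff ends c e ^ 2 := by
  induction h with
  | refl => exact ⟨0, by simp⟩
  | @tail b w _ hstep ih =>
    obtain ⟨N, hN⟩ := ih
    obtain ⟨e, he, hbw⟩ := hstep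
    refine ⟨2 * N + 2, fun c => ?_⟩
    have h₁ := hN c
    have h₂ : (c b - c w) ^ 2 ≤ ∑ e ∈ A, edgeDiff ends c e ^ 2 := by
      have h₃ : (c b - c w) ^ 2 = edgeDiff ends c e ^ 2 := by
        simp only [eSym, Sym2.eq_iff] at hbw
        rcases hbw with ⟨hb, hw⟩ | ⟨hb, hw⟩ <;> simp only [edgeDiff, hb, hw]
        ring
      rw [h₃]
      exact Finset.single_le_sum (f := fun e => edgeDiff ends c e ^ 2)
        (fun _ _ => sq_nonneg _) he
    push_cast
    nlinarith [sq_nonneg ((c v - c b) - (c b - c w))]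

lemma Conn.exists_sum_sq_le {ends : E → V × V} {A : Finset E} (h : Conn ends A) (v₀ : V) :
    ∃ N : ℕ, ∀ c : V → ℤ, c v₀ = 0 → ∑ v, c v ^ 2 ≤ N * ∑ e ∈ A, edgeDiff ends c e ^ 2 := by
  choose N hN using fun v => (h.2 v v₀).exists_sq_le
  refine ⟨∑ v, N v, fun c hc => ?_⟩
  push_cast
  rw [Finset.sum_mul]
  exact Finset.sum_le_sum fun v _ => by simpa [hc] using hN v c

/-- The quadratic function whose integral minimizers produce semistable multidegrees. -/
noncomputable def energy (ends : E → V × V) (A : Finset E) (r : V → ℝ) (c : V → ℤ) : ℝ :=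
  ((∑ e ∈ A, edgeDiff ends c e ^ 2 : ℤ) : ℝ) - 2 * ∑ v, (c v : ℝ) * r v

lemma energy_sub_const (ends : E → V × V) (A : Finset E) {r : V → ℝ} (hr : ∑ v, r v = 0)
    (c : V → ℤ) (k : ℤ) : energy ends A r (fun v => c v - k) = energy ends A r c := by
  simp [energy, edgeDiff, sub_mul, Finset.sum_sub_distrib, ← Finset.mul_sum, hr]

lemma Conn.exists_energy_le {ends : E → V × V} {A : Finset E} (h : Conn ends A) {r : V → ℝ}
    (hr : ∑ v, r v = 0) : ∃ c, ∀ c', energy ends A r c ≤ energy ends A r c' := by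
  obtain ⟨v₀⟩ := h.1
  obtain ⟨N, hN⟩ := h.exists_sum_sq_le v₀
  let S : Set (V → ℤ) := {c | c v₀ = 0 ∧ energy ends A r c ≤ 0}
  have h0 : energy ends A r 0 = 0 := by simp [energy, edgeDiff]
  have hfin : S.Finite := by
    obtain ⟨B, hB⟩ := exists_nat_ge (4 * (N : ℝ) ^ 2 * ∑ v, r v ^ 2)
    refine (Set.finite_Icc (fun _ : V => -(B : ℤ)) (fun _ => (B : ℤ))).subset ?_
    rintro c ⟨hc₀, hc⟩
    have h₁ : ∑ v, (c v : ℝ) ^ 2 ≤ N * ((∑ e ∈ A, edgeDiff ends c e ^ 2 : ℤ) : ℝ) := by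
      exact_mod_cast hN c hc₀
    have h₂ : (N : ℝ) * ((∑ e ∈ A, edgeDiff ends c e ^ 2 : ℤ) : ℝ) ≤
        N * (2 * ∑ v, (c v : ℝ) * r v) := by
      refine mul_le_mul_of_nonneg_left ?_ (Nat.cast_nonneg N)
      unfold energy at hc
      linarith
    have h₃ : N * (2 * ∑ v, (c v : ℝ) * r v) ≤
        (∑ v, (c v : ℝ) ^ 2) / 2 + 2 * (N : ℝ) ^ 2 * ∑ v, r v ^ 2 := by
      rw [Finset.sum_div, Finset.mul_sum, Finset.mul_sum, Finset.mul_sum,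
        ← Finset.sum_add_distrib]
      exact Finset.sum_le_sum fun v _ => by nlinarith [sq_nonneg ((c v : ℝ) - 2 * N * r v)]
    have h₄ : ∑ v, (c v : ℝ) ^ 2 ≤ B := by linarith
    have h₅ : ∑ v, c v ^ 2 ≤ B := by exact_mod_cast h₄
    have h₆ : ∀ v, |c v| ≤ B := fun v =>
      calc |c v| ≤ c v ^ 2 := by
            rw [← sq_abs]
            exact Int.le_self_sq _
        _ ≤ ∑ v, c v ^ 2 :=
            Finset.single_le_sum (f := fun v => c v ^ 2) (fun _ _ => sq_nonneg _) (mem_univ v)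
        _ ≤ B := h₅
    exact ⟨fun v => (abs_le.1 (h₆ v)).1, fun v => (abs_le.1 (h₆ v)).2⟩
  obtain ⟨c, hcS, hc⟩ := Set.exists_min_image S (energy ends A r) hfin ⟨0, rfl, h0.le⟩
  refine ⟨c, fun c' => ?_⟩
  rw [← energy_sub_const ends A hr c' (c' v₀)]
  by_cases h' : energy ends A r (fun v => c' v - c' v₀) ≤ 0
  · exact hc _ ⟨sub_self _, h'⟩
  · exact hcS.2.trans (not_le.1 h').le

lemma energy_add (ends : E → V × V) (A : Finset E) (r : V → ℝ) (c b : V → ℤ) :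
    energy ends A r (c + b) = energy ends A r c
      + ((∑ e ∈ A, edgeDiff ends b e ^ 2 : ℤ) : ℝ)
      - 2 * ∑ w, (b w : ℝ) * (r w + twComb ends A c w) := by
  have h : ∑ w, (b w : ℝ) * twComb ends A c w =
      -∑ e ∈ A, (edgeDiff ends b e : ℝ) * edgeDiff ends c e := by
    exact_mod_cast sum_mul_twComb ends A b c
  simp only [mul_add, Finset.sum_add_distrib, h]
  have hq : ((∑ e ∈ A, edgeDiff ends (c + b) e ^ 2 : ℤ) : ℝ) =
      (∑ e ∈ A, edgeDiff ends c e ^ 2 : ℤ) + (∑ e ∈ A, edgeDiff ends b e ^ 2 : ℤ) +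
        2 * ∑ e ∈ A, (edgeDiff ends b e : ℝ) * edgeDiff ends c e := by
    push_cast
    rw [Finset.mul_sum, ← Finset.sum_add_distrib, ← Finset.sum_add_distrib]
    refine Finset.sum_congr rfl fun e _ => ?_
    simp only [edgeDiff, Pi.add_apply]
    push_cast
    ring
  unfold energy
  rw [hq]
  simp only [Pi.add_apply, Int.cast_add, add_mul, Finset.sum_add_distrib]
  ring

lemma phiSemistable_add_twComb {ends : E → V × V} {φ : V → ℝ} {A : Finset E} {x c : V → ℤ}
    (hc : ∀ c', energy ends A (deviation ends φ A x) c ≤ energy ends A (deviation ends φ A x) c') :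
    PhiSemistable ends φ A (x + twComb ends A c) := by
  rw [phiSemistable_iff]
  intro W _ _
  have h₁ := hc (c + indVec W)
  have h₂ := hc (c + -indVec W)
  have hneg : ∑ e ∈ A, edgeDiff ends (-indVec W) e ^ 2 =
      ∑ e ∈ A, edgeDiff ends (indVec W) e ^ 2 :=
    Finset.sum_congr rfl fun e _ => by simp only [edgeDiff, Pi.neg_apply]; ring
  have hsum : ∑ w, (indVec W w : ℝ) * (deviation ends φ A x w + twComb ends A c w) =
      ∑ w ∈ W, deviation ends φ A (x + twComb ends A c) w := by
    simp [indVec, deviation_add]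
  rw [energy_add] at h₁ h₂
  simp only [hneg, Pi.neg_apply, Int.cast_neg, neg_mul, Finset.sum_neg_distrib] at h₂
  rw [hsum, sum_edgeDiff_indVec_sq, Int.cast_natCast] at h₁ h₂
  rw [abs_le]
  constructor <;> linarith

/-- For a connected multigraph `Γ` and a nondegenerate numerical
polarization `φ ∈ V^d(Γ)`, the numerical assignment `stab_{Γ,φ}` is a degree-`d`
stability assignment for `Γ`. -/
theorem statement9 (ends : E → V × V) (d : ℤ) (φ : V → ℝ)
    (hconn : Conn ends (Finset.univ : Finset E))
    (hφ : ∑ v : V, φ v = (d : ℝ)) (hnd : Nondegenerate ends d φ) :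
    IsStabilityAssignment ends d (stabAssign ends d φ) := by
  refine ⟨fun A x hx => ⟨hx.1, hx.2.1⟩, fun A x hx e he v hv =>
    ⟨hx.1.insert_edge e, add_stdVec_mem_Sdeg hx.2.1 he v, hx.2.2.insert_edge he hv⟩,
    fun A hA => ⟨fun x hx => hx.2.1, fun x hx => ?_⟩⟩
  obtain ⟨c, hc⟩ := hA.exists_energy_le (sum_univ_deviation (ends := ends) hφ hx)
  have hdeg : x + twComb ends A c ∈ Sdeg d A := by
    simp only [Sdeg, Set.mem_ofPred_eq] at hx ⊢
    simp [Finset.sum_add_distrib, sum_twComb, hx]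
  have hss := phiSemistable_add_twComb hc
  have hmem : twComb ends A c ∈ twGroup ends A := (mem_twGroup_iff_s9 ends A _).2 ⟨c, rfl⟩
  refine ⟨x + twComb ends A c, ⟨⟨hA, hdeg, hss⟩, ?_⟩, ?_⟩
  · simpa using hmem
  · rintro y ⟨⟨-, hy, hyss⟩, hxy⟩
    refine (hnd A y hy hyss).eq_of_sub_mem_twGroup (hnd A _ hdeg hss) ?_
    have h : y - (x + twComb ends A c) = -(x - y) - twComb ends A c := by abel
    rw [h]
    exact sub_mem (neg_mem hxy) hmem
end

section
/- Let Γ be a finite connected multigraph and let φ ∈ V^d(Γ) be nondegenerate. Then for every spanning subgraph G of Γ that is disconnected, no element of S^d_Γ(G) is φ-semistable on G; i.e. stab_{Γ,φ}(G) = ∅. -/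
open Finset

variable {V E : Type} [Fintype V] [Fintype E] [DecidableEq V] [DecidableEq E]

/-- A disconnected spanning subgraph on a nonempty vertex set has a nonempty proper vertex subset
crossed by none of its edges. -/
theorem exists_inter_cutE_eq_empty_of_not_conn [Nonempty V] (ends : E → V × V) (A : Finset E)
    (hA : ¬ Conn ends A) :
    ∃ W : Finset V, W.Nonempty ∧ W ≠ Finset.univ ∧ A ∩ cutE ends W = ∅ := by
  classical
  obtain ⟨v, w, hvw⟩ : ∃ v w : V, ¬ Linked ends A v w := by
    by_contra! h
    exact hA ⟨inferInstance, h⟩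
  refine ⟨Finset.univ.filter (Linked ends A v), ⟨v, ?_⟩, fun h => hvw ?_, ?_⟩
  · exact Finset.mem_filter.2 ⟨Finset.mem_univ v, Relation.ReflTransGen.refl⟩
  · simpa using h.ge (Finset.mem_univ w)
  · refine Finset.eq_empty_of_forall_notMem fun e he => ?_
    simp only [cutE, Finset.mem_inter, Finset.mem_filter, Finset.mem_univ, true_and] at he
    obtain ⟨heA, ⟨h1, h2⟩ | ⟨h1, h2⟩⟩ := he
    · exact h2 (Relation.ReflTransGen.tail h1 ⟨e, heA, rfl⟩)
    · exact h1 (Relation.ReflTransGen.tail h2 ⟨e, heA, Sym2.eq_swap⟩)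

/-- Stability forces connectedness. -/
theorem PhiStable.conn [Nonempty V] {ends : E → V × V} {φ : V → ℝ} {A : Finset E} {x : V → ℤ}
    (h : PhiStable ends φ A x) : Conn ends A := by
  by_contra hA
  obtain ⟨W, hne, huniv, hcut⟩ := exists_inter_cutE_eq_empty_of_not_conn ends A hA
  have hlt := h W hne huniv
  rw [hcut, Finset.card_empty, Nat.cast_zero, zero_div] at hlt
  exact (abs_nonneg _).not_gt hlt

/-- For a connected multigraph `Γ` and a nondegenerate `φ ∈ V^d(Γ)`,
no multidegree in `S^d_Γ(G)` is `φ`-semistable on a disconnected spanning subgraph `G`. -/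
theorem statement10 (ends : E → V × V) (d : ℤ) (φ : V → ℝ)
    (hconn : Conn ends (Finset.univ : Finset E))
    (hφ : ∑ v : V, φ v = (d : ℝ)) (hnd : Nondegenerate ends d φ)
    (G : Finset E) (hG : ¬ Conn ends G) :
    ∀ x : V → ℤ, x ∈ Sdeg d G → ¬ PhiSemistable ends φ G x := by
  intro x hx hss
  have := hconn.1
  exact hG (hnd G x hx hss).conn
end
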